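/- arXiv:math/0606151 — 2 statements merged into one kernel-verified Lean document; each statement's English description precedes it below -/
import Mathlib

section
/- Let N ≥ 3 and let Ω ⊂ ℝ^N be a smooth bounded domain containing the origin. Then there exists a constant K₃ > 0 such that for every nonnegative u ∈ C₀^∞(Ω \ {0}) with u not identically zero and every ε > 0, ∫_Ω u(x)² · log( u(x) / ( ‖u‖₂ · |x|^{(2−N)/2} · d(x) ) ) dx ≤ ε · ∫_Ω ( |∇u|² − ((N−2)²/(4|x|²)) u² ) dx + ( K₃ − ((N+2)/4) · log ε ) · ‖u‖₂², where ‖u‖₂ := (∫_Ω u² dx)^{1/2}. -/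
open MeasureTheory Real

noncomputable section

/-- A set `Ω ⊆ ℝ^N` is a C² domain: it is the sublevel set of a C² function whose
differential does not vanish on the boundary. -/
def IsC2Domain {N : ℕ} (Ω : Set (EuclideanSpace ℝ (Fin N))) : Prop :=
  ∃ φ : EuclideanSpace ℝ (Fin N) → ℝ,
    ContDiff ℝ 2 φ ∧ Ω = {x | φ x < 0} ∧ ∀ x ∈ frontier Ω, fderiv ℝ φ x ≠ 0

/-- Distance to the boundary of `Ω`. -/
def bdist {N : ℕ} (Ω : Set (EuclideanSpace ℝ (Fin N))) (x : EuclideanSpace ℝ (Fin N)) : ℝ :=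
  Metric.infDist x (frontier Ω)

/-- A function vanishing off a compact `K` and continuous on an open `U ⊇ K` is integrable. -/
lemma intK {N : ℕ} {K U : Set (EuclideanSpace ℝ (Fin N))} (hK : IsCompact K) (hU : IsOpen U)
    (hKU : K ⊆ U) {f : EuclideanSpace ℝ (Fin N) → ℝ} (h0 : ∀ x, x ∉ K → f x = 0)
    (hf : ContinuousOn f U) : Integrable f := by
  have hc : Continuous f := by
    rw [continuous_iff_continuousAt]
    intro x
    by_cases hx : x ∈ K
    · exact hf.continuousAt (hU.mem_nhds (hKU hx))
    · have : f =ᶠ[nhds x] fun _ => 0 := by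
        filter_upwards [hK.isClosed.isOpen_compl.mem_nhds hx] with y hy using h0 y hy
      exact this.continuousAt
  exact hc.integrable_of_hasCompactSupport (HasCompactSupport.intro hK h0)

lemma fd_zero {N : ℕ} {u : EuclideanSpace ℝ (Fin N) → ℝ} {x : EuclideanSpace ℝ (Fin N)}
    (hx : x ∉ tsupport u) : fderiv ℝ u x = 0 := by
  by_contra h
  exact hx (support_fderiv_subset ℝ h)

lemma u_zero {N : ℕ} {u : EuclideanSpace ℝ (Fin N) → ℝ} {x : EuclideanSpace ℝ (Fin N)}
    (hx : x ∉ tsupport u) : u x = 0 := image_eq_zero_of_notMem_tsupport hx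

/-- partial derivative -/
def pd {N : ℕ} (i : Fin N) (u : EuclideanSpace ℝ (Fin N) → ℝ) (x : EuclideanSpace ℝ (Fin N)) : ℝ :=
  fderiv ℝ u x (EuclideanSpace.single i 1)

lemma pd_zero {N : ℕ} {u : EuclideanSpace ℝ (Fin N) → ℝ} {x : EuclideanSpace ℝ (Fin N)} (i : Fin N)
    (hx : x ∉ tsupport u) : pd i u x = 0 := by simp [pd, fd_zero hx]

lemma pd_cont {N : ℕ} {u : EuclideanSpace ℝ (Fin N) → ℝ} (hu : ContDiff ℝ 1 u) (i : Fin N) :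
    Continuous (pd i u) := by
  unfold pd
  exact (hu.continuous_fderiv one_ne_zero).clm_apply continuous_const

lemma pd_contOn {N : ℕ} {u : EuclideanSpace ℝ (Fin N) → ℝ} {U : Set (EuclideanSpace ℝ (Fin N))}
    (hU : IsOpen U) (hu : ContDiffOn ℝ 1 u U) (i : Fin N) :
    ContinuousOn (pd i u) U := by
  unfold pd
  exact (hu.continuousOn_fderiv_of_isOpen hU le_rfl).clm_apply continuousOn_const

lemma norm_fderiv_sq {N : ℕ} (u : EuclideanSpace ℝ (Fin N) → ℝ) (x : EuclideanSpace ℝ (Fin N)) :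
    ‖fderiv ℝ u x‖ ^ 2 = ∑ i, pd i u x ^ 2 := by
  have h1 : ‖fderiv ℝ u x‖ = ‖gradient u x‖ := by simp [gradient]
  rw [h1, EuclideanSpace.norm_sq_eq]
  refine Finset.sum_congr rfl fun i _ => ?_
  have : (gradient u x) i = pd i u x := by
    have h2 : inner ℝ (gradient u x) (EuclideanSpace.single i (1:ℝ)) = pd i u x := by
      simp only [gradient, pd, InnerProductSpace.toDual_symm_apply]
    rw [← h2, EuclideanSpace.inner_single_right]; simp
  rw [this, Real.norm_eq_abs, sq_abs]

lemma norm_gradient_sq {N : ℕ} (u : EuclideanSpace ℝ (Fin N) → ℝ) (x : EuclideanSpace ℝ (Fin N)) :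
    ‖gradient u x‖ ^ 2 = ∑ i, pd i u x ^ 2 := by
  rw [← norm_fderiv_sq]; simp [gradient]

lemma ibp {N : ℕ} {u : EuclideanSpace ℝ (Fin N) → ℝ} {U : Set (EuclideanSpace ℝ (Fin N))}
    (hu : ContDiff ℝ 1 u) (hc : HasCompactSupport u) (hU : IsOpen U) (hs : tsupport u ⊆ U)
    {g : EuclideanSpace ℝ (Fin N) → ℝ} (hg : ContDiffOn ℝ 1 g U) (i : Fin N) :
    ∫ x, u x ^ 2 * pd i g x = - ∫ x, 2 * u x * pd i u x * g x := by
  have hgc := pd_contOn hU hg i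
  have hgc0 := hg.continuousOn
  have huc := hu.continuous
  have hpc := pd_cont hu i
  have hd : ∀ x, fderiv ℝ (fun x => u x ^ 2) x (EuclideanSpace.single i 1) = 2 * u x * pd i u x := by
    intro x
    have := ((hu.differentiable one_ne_zero) x).hasFDerivAt.pow 2
    rw [HasFDerivAt.fderiv this]
    simp [pd]
  have key := integral_mul_fderiv_eq_neg_fderiv_mul_of_integrable (μ := volume)
    (f := fun x => u x ^ 2) (g := g) (v := EuclideanSpace.single i (1:ℝ)) ?_ ?_ ?_ ?_ ?_
  · simp only [hd] at key
    exact key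
  · simp only [hd]
    refine intK hc hU hs (fun x hx => by simp [u_zero hx]) (by fun_prop)
  · refine intK hc hU hs (fun x hx => by simp [u_zero hx]) ?_
    exact (huc.pow 2).continuousOn.mul hgc
  · exact intK hc hU hs (fun x hx => by simp [u_zero hx]) (by fun_prop)
  · intro x _
    exact ((hu.differentiable one_ne_zero) x).pow 2
  · intro x hx
    have hx' : x ∈ tsupport u := by
      refine closure_mono ?_ hx
      intro y hy
      simp only [Function.mem_support] at hy ⊢
      intro h; simp [h] at hy
    exact (hg.contDiffAt (hU.mem_nhds (hs hx'))).differentiableAt one_ne_zero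

/-- Vector field identity. -/
lemma vf {N : ℕ} {u : EuclideanSpace ℝ (Fin N) → ℝ} {U : Set (EuclideanSpace ℝ (Fin N))}
    (hu : ContDiff ℝ 1 u) (hc : HasCompactSupport u) (hU : IsOpen U) (hs : tsupport u ⊆ U)
    {F : Fin N → EuclideanSpace ℝ (Fin N) → ℝ} (hF : ∀ i, ContDiffOn ℝ 1 (F i) U) :
    ∫ x, ∑ i, (pd i u x + F i x * u x) ^ 2 =
      (∫ x, ∑ i, pd i u x ^ 2) - ∫ x, (∑ i, (pd i (F i) x - F i x ^ 2)) * u x ^ 2 := by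
  have huc := hu.continuous
  have hpc := fun i => pd_cont hu i
  have hFc := fun i => (hF i).continuousOn
  have hFd := fun i => pd_contOn hU (hF i) i
  have i1 : ∀ i, Integrable (fun x => pd i u x ^ 2) := fun i =>
    intK hc hU hs (fun x hx => by simp [pd_zero i hx]) (by have := hpc i; fun_prop)
  have i2 : ∀ i, Integrable (fun x => u x ^ 2 * pd i (F i) x) := fun i =>
    intK hc hU hs (fun x hx => by simp [u_zero hx]) (by have := hFd i; fun_prop)
  have i3 : ∀ i, Integrable (fun x => 2 * u x * pd i u x * F i x) := fun i =>
    intK hc hU hs (fun x hx => by simp [u_zero hx]) (by have := hpc i; have := hFc i; fun_prop)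
  have i4 : ∀ i, Integrable (fun x => u x ^ 2 * F i x ^ 2) := fun i =>
    intK hc hU hs (fun x hx => by simp [u_zero hx]) (by have := hFc i; fun_prop)
  have e1 : ∫ x, ∑ i, (pd i u x + F i x * u x) ^ 2
      = ∑ i, ((∫ x, pd i u x ^ 2) + (∫ x, 2 * u x * pd i u x * F i x) + ∫ x, u x ^ 2 * F i x ^ 2) := by
    have : ∀ x, ∑ i, (pd i u x + F i x * u x) ^ 2
      = ∑ i, (pd i u x ^ 2 + 2 * u x * pd i u x * F i x + u x ^ 2 * F i x ^ 2) := fun x =>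
      Finset.sum_congr rfl fun i _ => by ring
    simp_rw [this]
    have i5 : ∀ i, Integrable (fun x => pd i u x ^ 2 + 2 * u x * pd i u x * F i x) :=
      fun i => (i1 i).add (i3 i)
    have i6 : ∀ i, Integrable
        (fun x => pd i u x ^ 2 + 2 * u x * pd i u x * F i x + u x ^ 2 * F i x ^ 2) :=
      fun i => (i5 i).add (i4 i)
    rw [integral_finsetSum _ fun i _ => i6 i]
    refine Finset.sum_congr rfl fun i _ => ?_
    rw [integral_add (i5 i) (i4 i), integral_add (i1 i) (i3 i)]
  have e2 : ∫ x, (∑ i, (pd i (F i) x - F i x ^ 2)) * u x ^ 2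
      = ∑ i, ((∫ x, u x ^ 2 * pd i (F i) x) - ∫ x, u x ^ 2 * F i x ^ 2) := by
    have : ∀ x, (∑ i, (pd i (F i) x - F i x ^ 2)) * u x ^ 2
      = ∑ i, (u x ^ 2 * pd i (F i) x - u x ^ 2 * F i x ^ 2) := fun x => by
      rw [Finset.sum_mul]
      exact Finset.sum_congr rfl fun i _ => by ring
    simp_rw [this]
    have i5 : ∀ i, Integrable (fun x => u x ^ 2 * pd i (F i) x - u x ^ 2 * F i x ^ 2) :=
      fun i => (i2 i).sub (i4 i)
    rw [integral_finsetSum _ fun i _ => i5 i]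
    refine Finset.sum_congr rfl fun i _ => ?_
    rw [integral_sub (i2 i) (i4 i)]
  rw [e1, e2, integral_finsetSum _ fun i _ => i1 i, ← Finset.sum_sub_distrib]
  refine Finset.sum_congr rfl fun i _ => ?_
  rw [ibp hu hc hU hs (hF i) i]
  ring

lemma hasFDerivAt_rp {N : ℕ} (p : ℝ) {x : EuclideanSpace ℝ (Fin N)} (hx : x ≠ 0) :
    HasFDerivAt (fun y : EuclideanSpace ℝ (Fin N) => ‖y‖ ^ p)
      ((p * ‖x‖ ^ (p - 2)) • innerSL ℝ x) x := by
  have hn : 0 < ‖x‖ := norm_pos_iff.2 hx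
  have h1 : HasFDerivAt (fun y : EuclideanSpace ℝ (Fin N) => ‖y‖ ^ 2) (2 • innerSL ℝ x) x :=
    (hasStrictFDerivAt_norm_sq x).hasFDerivAt
  have h2 := h1.rpow_const (p := p / 2) (Or.inl (by positivity))
  have h3 : ∀ (q : ℝ) (y : EuclideanSpace ℝ (Fin N)), (‖y‖ ^ 2) ^ (q / 2) = ‖y‖ ^ q := by
    intro q y
    rw [← Real.rpow_natCast, ← Real.rpow_mul (norm_nonneg _)]
    congr 1; push_cast; ring
  simp only [h3] at h2
  have h4 : p / 2 - 1 = (p - 2) / 2 := by ring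
  rw [h4, h3] at h2
  have h5 : (p * ‖x‖ ^ (p - 2)) • innerSL ℝ x = (p / 2 * ‖x‖ ^ (p - 2)) • 2 • innerSL ℝ x := by
    ext v
    simp
    ring
  rw [h5]
  exact h2

lemma contDiffOn_rp {N : ℕ} (p : ℝ) :
    ContDiffOn ℝ 1 (fun y : EuclideanSpace ℝ (Fin N) => ‖y‖ ^ p) {0}ᶜ := by
  intro x hx
  have : ContDiffAt ℝ 1 (fun y : EuclideanSpace ℝ (Fin N) => ‖y‖) x := contDiffAt_norm ℝ hx
  exact (this.rpow_const_of_ne (norm_ne_zero_iff.2 hx)).contDiffWithinAt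

lemma pd_rp {N : ℕ} (p : ℝ) {x : EuclideanSpace ℝ (Fin N)} (hx : x ≠ 0) (i : Fin N) :
    pd i (fun y : EuclideanSpace ℝ (Fin N) => ‖y‖ ^ p) x = p * ‖x‖ ^ (p - 2) * x i := by
  rw [pd, (hasFDerivAt_rp p hx).fderiv]
  simp [EuclideanSpace.inner_single_right]

lemma pd_mul {N : ℕ} {f g : EuclideanSpace ℝ (Fin N) → ℝ} {x : EuclideanSpace ℝ (Fin N)}
    (hf : DifferentiableAt ℝ f x) (hg : DifferentiableAt ℝ g x) (i : Fin N) :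
    pd i (fun y => f y * g y) x = pd i f x * g x + f x * pd i g x := by
  rw [pd, (hf.hasFDerivAt.fun_mul hg.hasFDerivAt).fderiv]
  simp [pd]; ring

lemma pd_coord {N : ℕ} (x : EuclideanSpace ℝ (Fin N)) (i : Fin N) :
    pd i (fun y : EuclideanSpace ℝ (Fin N) => y i) x = 1 := by
  have : HasFDerivAt (fun y : EuclideanSpace ℝ (Fin N) => y i) (EuclideanSpace.proj i : _ →L[ℝ] ℝ) x :=
    (EuclideanSpace.proj i : EuclideanSpace ℝ (Fin N) →L[ℝ] ℝ).hasFDerivAt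
  rw [pd, this.fderiv]
  simp

lemma sum_coord_sq {N : ℕ} (x : EuclideanSpace ℝ (Fin N)) : ∑ i, x i ^ 2 = ‖x‖ ^ 2 := by
  rw [EuclideanSpace.norm_sq_eq]; simp

lemma rp_contOn {N : ℕ} (p : ℝ) :
    ContinuousOn (fun y : EuclideanSpace ℝ (Fin N) => ‖y‖ ^ p) {0}ᶜ := (contDiffOn_rp p).continuousOn

lemma rp_mul_sq {r : ℝ} (hr : 0 < r) (p : ℝ) : r ^ (p - 2) * r ^ 2 = r ^ p := by
  rw [← Real.rpow_natCast r 2, ← Real.rpow_add hr]; congr 1; push_cast; ring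

/-- The radial vector field. -/
def radF {N : ℕ} (h κ a : ℝ) (i : Fin N) (x : EuclideanSpace ℝ (Fin N)) : ℝ :=
  (h * ‖x‖ ^ (-2 : ℝ) + κ * ‖x‖ ^ (2 * a - 2)) * x i

lemma radF_contDiff {N : ℕ} (h κ a : ℝ) (i : Fin N) :
    ContDiffOn ℝ 1 (radF (N := N) h κ a i) {0}ᶜ := by
  unfold radF
  have h1 := contDiffOn_rp (N := N) (-2)
  have h2 := contDiffOn_rp (N := N) (2 * a - 2)
  have h3 : ContDiffOn ℝ 1 (fun y : EuclideanSpace ℝ (Fin N) => y i) {0}ᶜ :=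
    (EuclideanSpace.proj i : EuclideanSpace ℝ (Fin N) →L[ℝ] ℝ).contDiff.contDiffOn
  exact ((contDiffOn_const.mul h1).add (contDiffOn_const.mul h2)).mul h3

lemma radF_div {N : ℕ} (h κ a : ℝ) (hh : (N : ℝ) = 2 * h + 2) {x : EuclideanSpace ℝ (Fin N)}
    (hx : x ≠ 0) :
    ∑ i, (pd i (radF h κ a i) x - radF h κ a i x ^ 2) =
      h ^ 2 * ‖x‖ ^ (-2 : ℝ) + κ * ‖x‖ ^ (2 * a - 2) * (2 * a - κ * ‖x‖ ^ (2 * a)) := by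
  have hn : 0 < ‖x‖ := norm_pos_iff.2 hx
  set c : ℝ := h * (-2 * ‖x‖ ^ (-2 - 2 : ℝ)) + κ * ((2 * a - 2) * ‖x‖ ^ (2 * a - 2 - 2)) with hc
  set f : ℝ := h * ‖x‖ ^ (-2 : ℝ) + κ * ‖x‖ ^ (2 * a - 2) with hf
  have hpd : ∀ i, pd i (radF h κ a i) x = c * x i ^ 2 + f := by
    intro i
    have d1 := hasFDerivAt_rp (-2) hx
    have d2 := hasFDerivAt_rp (2 * a - 2) hx
    have d3 : HasFDerivAt (fun y : EuclideanSpace ℝ (Fin N) => y i)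
      (EuclideanSpace.proj i : _ →L[ℝ] ℝ) x :=
      (EuclideanSpace.proj i : EuclideanSpace ℝ (Fin N) →L[ℝ] ℝ).hasFDerivAt
    have d4 := ((d1.const_mul h).fun_add (d2.const_mul κ)).fun_mul d3
    unfold radF pd
    rw [d4.fderiv]
    generalize ‖x‖ ^ (-2 : ℝ) = X at *
    simp [EuclideanSpace.inner_single_right]
    rw [hc, hf]
    ring
  have hF : ∀ i, radF h κ a i x = f * x i := fun i => rfl
  simp only [hpd, hF, mul_pow]
  rw [Finset.sum_sub_distrib, Finset.sum_add_distrib, ← Finset.mul_sum, ← Finset.mul_sum,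
    sum_coord_sq]
  simp only [Finset.sum_const, Finset.card_univ, Fintype.card_fin, nsmul_eq_mul]
  have e1 := rp_mul_sq hn (-2)
  have e2 := rp_mul_sq hn (2 * a - 2)
  have e3 := rp_mul_sq hn 0
  have e4 := rp_mul_sq hn (2 * a)
  rw [zero_sub, Real.rpow_zero] at e3
  rw [hh, ← e4]
  have e5 : c * ‖x‖ ^ 2 = h * (-2 * ‖x‖ ^ (-2 : ℝ)) + κ * ((2 * a - 2) * ‖x‖ ^ (2 * a - 2)) := by
    rw [hc, ← e1, ← e2]; ring
  rw [e5, hf]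
  linear_combination (-h ^ 2 * ‖x‖ ^ (-2 : ℝ) - 2 * h * κ * ‖x‖ ^ (2 * a - 2)) * e3

/-- The Hardy form. -/
def hQ {N : ℕ} (h : ℝ) (u : EuclideanSpace ℝ (Fin N) → ℝ) : ℝ :=
  (∫ x, ∑ i, pd i u x ^ 2) - ∫ x, h ^ 2 * ‖x‖ ^ (-2 : ℝ) * u x ^ 2

lemma hQ_vf {N : ℕ} {u : EuclideanSpace ℝ (Fin N) → ℝ} (h κ a : ℝ) (hh : (N : ℝ) = 2 * h + 2)
    (hu : ContDiff ℝ 1 u) (hc : HasCompactSupport u) (hs : tsupport u ⊆ {0}ᶜ) :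
    ∫ x, ∑ i, (pd i u x + radF h κ a i x * u x) ^ 2 =
      hQ h u - ∫ x, κ * ‖x‖ ^ (2 * a - 2) * (2 * a - κ * ‖x‖ ^ (2 * a)) * u x ^ 2 := by
  have huc := hu.continuous
  have c1 := rp_contOn (N := N) (-2)
  have c2 := rp_contOn (N := N) (2 * a - 2)
  have c3 := rp_contOn (N := N) (2 * a)
  have i1 : Integrable (fun x => h ^ 2 * ‖x‖ ^ (-2 : ℝ) * u x ^ 2) :=
    intK hc isOpen_compl_singleton hs (fun x hx => by simp [u_zero hx])
      ((continuousOn_const.mul c1).mul (huc.continuousOn.pow 2))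
  have i2 : Integrable (fun x => κ * ‖x‖ ^ (2 * a - 2) * (2 * a - κ * ‖x‖ ^ (2 * a)) * u x ^ 2) :=
    intK hc isOpen_compl_singleton hs (fun x hx => by simp [u_zero hx])
      (((continuousOn_const.mul c2).mul (continuousOn_const.sub (continuousOn_const.mul c3))).mul
        (huc.continuousOn.pow 2))
  rw [vf hu hc isOpen_compl_singleton hs (radF_contDiff h κ a), hQ, sub_sub, ← integral_add i1 i2]
  congr 1
  refine integral_congr_ae (Filter.Eventually.of_forall fun x => ?_)
  simp only
  by_cases hx : x = 0
  · have : u x = 0 := u_zero (fun h => hs h (by simpa using hx))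
    simp [this]
  · rw [radF_div h κ a hh hx]; ring

lemma w_props {N : ℕ} {u : EuclideanSpace ℝ (Fin N) → ℝ} (a : ℝ)
    (hu : ContDiff ℝ 1 u) (hs : tsupport u ⊆ {0}ᶜ) :
    ContDiff ℝ 1 (fun x => ‖x‖ ^ a * u x) ∧ tsupport (fun x => ‖x‖ ^ a * u x) ⊆ tsupport u := by
  have h2 : tsupport (fun x => ‖x‖ ^ a * u x) ⊆ tsupport u := tsupport_mul_subset_right
  refine ⟨?_, h2⟩
  rw [contDiff_iff_contDiffAt]
  intro x
  by_cases hx : x ∈ tsupport (fun x => ‖x‖ ^ a * u x)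
  swap
  · have : (fun x => ‖x‖ ^ a * u x) =ᶠ[nhds x] fun _ => 0 := notMem_tsupport_iff_eventuallyEq.1 hx
    exact contDiffAt_const.congr_of_eventuallyEq this
  exact ((contDiffOn_rp a).contDiffAt (isOpen_compl_singleton.mem_nhds (hs (h2 hx)))).mul
    hu.contDiffAt

lemma hardy {N : ℕ} (h a R : ℝ) (hh : (N : ℝ) = 2 * h + 2) (ha : 0 < a) (hR : 0 < R) :
    ∃ C : ℝ, 0 < C ∧ ∀ u : EuclideanSpace ℝ (Fin N) → ℝ, ContDiff ℝ 1 u → HasCompactSupport u →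
      tsupport u ⊆ {0}ᶜ → (∀ x ∈ tsupport u, ‖x‖ ≤ R) →
      (∫ x, ‖x‖ ^ (2 * a - 2) * u x ^ 2) ≤ C * hQ h u ∧
      (∫ x, ∑ i, pd i (fun x => ‖x‖ ^ a * u x) x ^ 2) ≤ C * hQ h u := by
  have hRa : 0 < R ^ (2 * a) := by positivity
  set κ := a / R ^ (2 * a) with hκ
  have hκ0 : 0 < κ := by positivity
  set C1 := 1 / (κ * a) with hC1
  have hC1p : 0 < C1 := by positivity
  refine ⟨C1 + (2 * R ^ (2 * a) + 2 * (h - a) ^ 2 * C1), by positivity, ?_⟩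
  intro u hu hc hs hb
  have huc := hu.continuous
  have hpc := fun i => pd_cont hu i
  have c1 := rp_contOn (N := N) (-2)
  have c2 := rp_contOn (N := N) (2 * a - 2)
  have c3 := rp_contOn (N := N) (2 * a)
  have i1 : Integrable (fun x => ‖x‖ ^ (2 * a - 2) * u x ^ 2) :=
    intK hc isOpen_compl_singleton hs (fun x hx => by simp [u_zero hx])
      (c2.mul (huc.continuousOn.pow 2))
  have i2 : Integrable (fun x => κ * ‖x‖ ^ (2 * a - 2) * (2 * a - κ * ‖x‖ ^ (2 * a)) * u x ^ 2) :=
    intK hc isOpen_compl_singleton hs (fun x hx => by simp [u_zero hx])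
      (((continuousOn_const.mul c2).mul (continuousOn_const.sub (continuousOn_const.mul c3))).mul
        (huc.continuousOn.pow 2))
  have r1 : ∀ x ∈ tsupport u, ‖x‖ ^ (2 * a) ≤ R ^ (2 * a) := fun x hx =>
    Real.rpow_le_rpow (norm_nonneg _) (hb x hx) (by positivity)
  have A1 : (∫ x, ‖x‖ ^ (2 * a - 2) * u x ^ 2) ≤ C1 * hQ h u := by
    have k1 := hQ_vf h κ a hh hu hc hs
    have k2 : 0 ≤ ∫ x, ∑ i, (pd i u x + radF h κ a i x * u x) ^ 2 :=
      integral_nonneg fun x => Finset.sum_nonneg fun i _ => sq_nonneg _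
    have k3 : ∫ x, (κ * a) * (‖x‖ ^ (2 * a - 2) * u x ^ 2) ≤
        ∫ x, κ * ‖x‖ ^ (2 * a - 2) * (2 * a - κ * ‖x‖ ^ (2 * a)) * u x ^ 2 := by
      refine integral_mono (i1.const_mul _) i2 fun x => ?_
      simp only
      by_cases hx : x ∈ tsupport u
      · have : κ * ‖x‖ ^ (2 * a) ≤ a := by
          calc κ * ‖x‖ ^ (2 * a) ≤ κ * R ^ (2 * a) := by gcongr; exact hb x hx
            _ = a := by rw [hκ]; field_simp
        have : 0 ≤ κ * ‖x‖ ^ (2 * a - 2) * u x ^ 2 := by positivity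
        nlinarith
      · simp [u_zero hx]
    rw [integral_const_mul] at k3
    rw [hC1, one_div, ← div_eq_inv_mul, le_div_iff₀ (by positivity)]
    linarith
  have Q0 : 0 ≤ hQ h u := by
    have : 0 ≤ ∫ x, ‖x‖ ^ (2 * a - 2) * u x ^ 2 := integral_nonneg fun x => by positivity
    exact nonneg_of_mul_nonneg_right (this.trans A1) hC1p
  have A2 : (∫ x, ∑ i, pd i (fun x => ‖x‖ ^ a * u x) x ^ 2) ≤
      2 * R ^ (2 * a) * hQ h u + 2 * (h - a) ^ 2 * ∫ x, ‖x‖ ^ (2 * a - 2) * u x ^ 2 := by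
    have k1 := hQ_vf h 0 a hh hu hc hs
    simp only [zero_mul, integral_zero, sub_zero] at k1
    rw [← k1, ← integral_const_mul, ← integral_const_mul]
    obtain ⟨w1, w2⟩ := w_props a hu hs
    have j1 : Integrable (fun x => ∑ i, pd i (fun x => ‖x‖ ^ a * u x) x ^ 2) := by
      refine intK hc isOpen_compl_singleton hs (fun x hx => ?_) ?_
      · simp [pd_zero _ (fun hx' => hx (w2 hx'))]
      · exact continuousOn_finsetSum _ fun i _ => ((pd_cont w1 i).continuousOn.pow 2)
    have j2 : Integrable (fun x => ∑ i, (pd i u x + radF h 0 a i x * u x) ^ 2) := by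
      refine intK hc isOpen_compl_singleton hs (fun x hx => ?_) ?_
      · simp [pd_zero _ hx, u_zero hx]
      · exact continuousOn_finsetSum _ fun i _ => ((hpc i).continuousOn.add
          (((radF_contDiff h 0 a i).continuousOn).mul huc.continuousOn)).pow 2
    rw [← integral_add (j2.const_mul _) (i1.const_mul _)]
    refine integral_mono j1 ((j2.const_mul _).add (i1.const_mul _)) fun x => ?_
    simp only
    by_cases hx : x ∈ tsupport u
    · have hx0 : x ≠ 0 := hs hx
      have hn : 0 < ‖x‖ := norm_pos_iff.2 hx0
      have dw : ∀ i, pd i (fun x => ‖x‖ ^ a * u x) x =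
          ‖x‖ ^ a * ((pd i u x + radF h 0 a i x * u x) - (h - a) * (‖x‖ ^ (-2 : ℝ) * u x * x i)) := by
        intro i
        rw [pd_mul (hasFDerivAt_rp a hx0).differentiableAt ((hu.differentiable one_ne_zero) x),
          pd_rp a hx0, radF]
        have : ‖x‖ ^ (a - 2) = ‖x‖ ^ a * ‖x‖ ^ (-2 : ℝ) := by
          rw [← Real.rpow_add hn]; congr 1
        rw [this]; ring
      have b1 : (‖x‖ ^ a) ^ 2 = ‖x‖ ^ (2 * a) := by
        rw [← Real.rpow_natCast, ← Real.rpow_mul hn.le]; congr 1; push_cast; ring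
      have b2 : ‖x‖ ^ (2 * a) * (‖x‖ ^ (-2 : ℝ)) ^ 2 * ‖x‖ ^ 2 = ‖x‖ ^ (2 * a - 2) := by
        rw [← Real.rpow_natCast, ← Real.rpow_natCast, ← Real.rpow_mul hn.le, ← Real.rpow_add hn,
          ← Real.rpow_add hn]; congr 1; push_cast; ring
      calc ∑ i, pd i (fun x => ‖x‖ ^ a * u x) x ^ 2
          ≤ ∑ i, ‖x‖ ^ (2 * a) * (2 * (pd i u x + radF h 0 a i x * u x) ^ 2 +
              2 * (h - a) ^ 2 * (‖x‖ ^ (-2 : ℝ)) ^ 2 * u x ^ 2 * x i ^ 2) := by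
            refine Finset.sum_le_sum fun i _ => ?_
            rw [dw i, mul_pow, b1]
            refine mul_le_mul_of_nonneg_left ?_ (by positivity)
            nlinarith [sq_nonneg ((pd i u x + radF h 0 a i x * u x) +
              (h - a) * (‖x‖ ^ (-2 : ℝ) * u x * x i))]
        _ = 2 * ‖x‖ ^ (2 * a) * ∑ i, (pd i u x + radF h 0 a i x * u x) ^ 2 +
              2 * (h - a) ^ 2 * (‖x‖ ^ (2 * a) * (‖x‖ ^ (-2 : ℝ)) ^ 2 * ‖x‖ ^ 2 * u x ^ 2) := by
            rw [← sum_coord_sq, ← Finset.mul_sum, Finset.sum_add_distrib, ← Finset.mul_sum,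
              ← Finset.mul_sum]
            ring
        _ ≤ _ := by
            rw [b2]
            gcongr
            exact hb x hx
    · simp [pd_zero _ (fun hx' => hx (w2 hx')), pd_zero _ hx, u_zero hx]
  constructor
  · refine A1.trans (mul_le_mul_of_nonneg_right ?_ Q0)
    have : 0 ≤ 2 * R ^ (2 * a) + 2 * (h - a) ^ 2 * C1 := by positivity
    linarith
  · have := mul_le_mul_of_nonneg_left A1 (by positivity : 0 ≤ 2 * (h - a) ^ 2)
    have := mul_nonneg hC1p.le Q0
    nlinarith

lemma sobolev (N : ℕ) (hN : 3 ≤ N) : ∃ C : ℝ, 0 < C ∧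
    ∀ w : EuclideanSpace ℝ (Fin N) → ℝ, ContDiff ℝ 1 w → HasCompactSupport w → (∀ x, 0 ≤ w x) →
      ∫ x, w x ^ (2 * N / (N - 2) : ℝ) ≤ (C * ∫ x, ∑ i, pd i w x ^ 2) ^ (N / (N - 2) : ℝ) := by
  have hN3 : (3 : ℝ) ≤ N := by exact_mod_cast hN
  have hN2 : (0 : ℝ) < N - 2 := by linarith
  have hN0 : (0 : ℝ) < N := by linarith
  set p' : NNReal := ⟨2 * N / (N - 2), by positivity⟩ with hp'
  have hp'r : (p' : ℝ) = 2 * N / (N - 2) := rfl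
  have hpos : (0:ℝ) < p' := by rw [hp'r]; positivity
  set K : NNReal := eLpNormLESNormFDerivOfEqInnerConst
    (volume : Measure (EuclideanSpace ℝ (Fin N))) ((2 : NNReal) : ℝ) with hK
  refine ⟨(K : ℝ) ^ 2 + 1, by positivity, ?_⟩
  intro w hw hc hw0
  have S := eLpNorm_le_eLpNorm_fderiv_of_eq_inner
    (volume : Measure (EuclideanSpace ℝ (Fin N))) hw hc (p := 2) (p' := p') (by norm_num)
    (by simp; omega) (by
      rw [hp'r]; simp only [finrank_euclideanSpace, Fintype.card_fin]; push_cast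
      field_simp)
  have hdc : Continuous (fderiv ℝ w) := hw.continuous_fderiv one_ne_zero
  have m1 : MemLp w p' volume := hw.continuous.memLp_of_hasCompactSupport hc
  have m2 : MemLp (fderiv ℝ w) (2 : NNReal) volume :=
    hdc.memLp_of_hasCompactSupport (hc.fderiv ℝ)
  rw [m1.eLpNorm_eq_integral_rpow_norm (by simpa using (NNReal.coe_pos.1 hpos).ne') (by simp),
    m2.eLpNorm_eq_integral_rpow_norm (by simp) (by simp), ← hK,
    ← ENNReal.ofReal_coe_nnreal (p := K), ← ENNReal.ofReal_mul (by positivity),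
    ENNReal.ofReal_le_ofReal_iff (by positivity)] at S
  simp only [ENNReal.coe_toReal, NNReal.coe_ofNat, Real.rpow_ofNat, norm_fderiv_sq,
    Real.norm_eq_abs, abs_of_nonneg (hw0 _), hp'r] at S
  set I := ∫ x, ∑ i, pd i w x ^ 2 with hI
  have hI0 : 0 ≤ I := integral_nonneg fun x => Finset.sum_nonneg fun i _ => sq_nonneg _
  set J := ∫ x, w x ^ (2 * N / (N - 2) : ℝ) with hJ
  have hJ0 : 0 ≤ J := integral_nonneg fun x => Real.rpow_nonneg (hw0 x) _
  have S2 := Real.rpow_le_rpow (by positivity) S hpos.le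
  rw [hp'r, ← Real.rpow_mul hJ0, inv_mul_cancel₀ (by positivity), Real.rpow_one] at S2
  refine S2.trans ?_
  have e : (K : ℝ) * I ^ (2 : ℝ)⁻¹ = ((K : ℝ) ^ 2 * I) ^ (2 : ℝ)⁻¹ := by
    rw [Real.mul_rpow (by positivity) hI0]
    congr 1
    rw [← Real.rpow_natCast, ← Real.rpow_mul (by positivity)]; simp
  rw [e, ← Real.rpow_mul (by positivity)]
  have : (2 : ℝ)⁻¹ * (2 * N / (N - 2)) = N / (N - 2) := by field_simp
  rw [this]
  refine Real.rpow_le_rpow (by positivity) ?_ (by positivity)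
  nlinarith

lemma frontier_ne {N : ℕ} (hN : 3 ≤ N) {Ω : Set (EuclideanSpace ℝ (Fin N))}
    (hΩb : Bornology.IsBounded Ω) (h0 : (0 : EuclideanSpace ℝ (Fin N)) ∈ Ω) :
    (frontier Ω).Nonempty := by
  by_contra h
  rw [Set.not_nonempty_iff_eq_empty, frontier_eq_empty_iff] at h
  rcases h with h | h
  · simp [h] at h0
  · have : Nonempty (Fin N) := ⟨⟨0, by omega⟩⟩
    rw [h] at hΩb
    exact NormedSpace.unbounded_univ ℝ _ hΩb

lemma bdist_pos {N : ℕ} (hN : 3 ≤ N) {Ω : Set (EuclideanSpace ℝ (Fin N))} (hΩo : IsOpen Ω)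
    (hΩb : Bornology.IsBounded Ω) (h0 : (0 : EuclideanSpace ℝ (Fin N)) ∈ Ω)
    {x : EuclideanSpace ℝ (Fin N)} (hx : x ∈ Ω) : 0 < bdist Ω x := by
  unfold bdist
  rw [← isClosed_frontier.notMem_iff_infDist_pos (frontier_ne hN hΩb h0)]
  intro h
  rw [hΩo.frontier_eq] at h
  exact h.2 hx

lemma bdist_cont {N : ℕ} (Ω : Set (EuclideanSpace ℝ (Fin N))) : Continuous (bdist Ω) :=
  Metric.continuous_infDist_pt _

lemma bdry_hardy {N : ℕ} (hN : 3 ≤ N) {Ω : Set (EuclideanSpace ℝ (Fin N))} (hΩo : IsOpen Ω)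
    (hΩb : Bornology.IsBounded Ω) (h0 : (0 : EuclideanSpace ℝ (Fin N)) ∈ Ω)
    (hΩ : IsC2Domain Ω) : ∃ C : ℝ, 0 < C ∧
    ∀ w : EuclideanSpace ℝ (Fin N) → ℝ, ContDiff ℝ 1 w → HasCompactSupport w → tsupport w ⊆ Ω →
      ∫ x, (bdist Ω x ^ 2)⁻¹ * w x ^ 2 ≤ C * ((∫ x, ∑ i, pd i w x ^ 2) + ∫ x, w x ^ 2) := by
  obtain ⟨φ, hφ, hΩφ, hfr⟩ := hΩ
  have hφ1 : ContDiff ℝ 1 φ := hφ.of_le (by norm_num)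
  have hφc : Continuous φ := hφ.continuous
  have hlt : ∀ x ∈ Ω, φ x < 0 := fun x hx => by rw [hΩφ] at hx; exact hx
  have hfr0 : ∀ x ∈ frontier Ω, φ x = 0 := by
    intro x hx
    rw [hΩo.frontier_eq] at hx
    have h1 : φ x ≤ 0 := by
      have : closure Ω ⊆ {x | φ x ≤ 0} :=
        closure_minimal (fun y hy => (hlt y hy).le) (isClosed_le hφc continuous_const)
      exact this hx.1
    refine le_antisymm h1 (not_lt.1 fun h => hx.2 ?_)
    rw [hΩφ]; exact h
  -- Lipschitz bound
  obtain ⟨R, hR⟩ := hΩb.closure.subset_closedBall (0 : EuclideanSpace ℝ (Fin N))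
  obtain ⟨L0, hL0⟩ := (isCompact_closedBall (0 : EuclideanSpace ℝ (Fin N)) R).exists_bound_of_continuousOn
    (hφ1.continuous_fderiv one_ne_zero).continuousOn
  set L := |L0| + 1 with hL
  have hLpos : 0 < L := by positivity
  have hLd : ∀ x ∈ Ω, |φ x| ≤ L * bdist Ω x := by
    intro x hx
    rw [← div_le_iff₀' hLpos]
    refine (Metric.le_infDist (frontier_ne hN hΩb h0)).2 fun y hy => ?_
    rw [div_le_iff₀' hLpos]
    have := (convex_closedBall (0 : EuclideanSpace ℝ (Fin N)) R).norm_image_sub_le_of_norm_fderiv_le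
      (𝕜 := ℝ) (f := φ) (C := L) (fun z _ => (hφ1.differentiable one_ne_zero) z)
      (fun z hz => (hL0 z hz).trans (by rw [hL]; linarith [le_abs_self L0]))
      (hR (frontier_subset_closure hy)) (hR (subset_closure hx))
    rw [hfr0 y hy, sub_zero, Real.norm_eq_abs] at this
    rwa [dist_eq_norm]
  -- second derivative bounds
  have hpd1 : ∀ i, ContDiff ℝ 1 (pd i φ) := fun i => by
    unfold pd
    exact (hφ.fderiv_right (m := 1) (by norm_num)).clm_apply contDiff_const
  have hlapc : Continuous (fun x => ∑ i, pd i (pd i φ) x) :=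
    continuous_finsetSum _ fun i _ => pd_cont (hpd1 i) i
  have hcomp : IsCompact (closure Ω) := hΩb.isCompact_closure
  obtain ⟨A0, hA0⟩ := hcomp.exists_bound_of_continuousOn hlapc.continuousOn
  have hSc : Continuous (fun x => (∑ i, pd i φ x ^ 2) + φ x ^ 2) :=
    (continuous_finsetSum _ fun i _ => (pd_cont hφ1 i).pow 2).add (hφc.pow 2)
  obtain ⟨x0, hx0, hmin⟩ := hcomp.exists_isMinOn ⟨0, subset_closure h0⟩ hSc.continuousOn
  set m := (∑ i, pd i φ x0 ^ 2) + φ x0 ^ 2 with hm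
  have hmpos : 0 < m := by
    have h1 : 0 ≤ ∑ i, pd i φ x0 ^ 2 := Finset.sum_nonneg fun i _ => sq_nonneg _
    by_cases hx : x0 ∈ Ω
    · have := hlt x0 hx
      have : 0 < φ x0 ^ 2 := by nlinarith
      linarith
    · have := hfr x0 (by rw [hΩo.frontier_eq]; exact ⟨hx0, hx⟩)
      have h2 : 0 < ∑ i, pd i φ x0 ^ 2 := by
        rw [← norm_fderiv_sq]
        have := norm_pos_iff.2 this
        positivity
      nlinarith [sq_nonneg (φ x0)]
  set A := |A0| with hA
  set C0 := 1 / 4 + A ^ 2 / (2 * m) with hC0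
  have hC0p : 0 < C0 := by positivity
  -- the vector field
  set F : Fin N → EuclideanSpace ℝ (Fin N) → ℝ :=
    fun i x => (-(1 / 2) * pd i φ x) * (φ x)⁻¹ with hF
  have hFc : ∀ i, ContDiffOn ℝ 1 (F i) Ω := fun i =>
    ((contDiff_const.mul (hpd1 i)).contDiffOn).mul
      (hφ1.contDiffOn.inv fun x hx => (hlt x hx).ne)
  have hdiv : ∀ x ∈ Ω, m / 8 * (φ x ^ 2)⁻¹ - C0 ≤ ∑ i, (pd i (F i) x - F i x ^ 2) := by
    intro x hx
    have hne : φ x ≠ 0 := (hlt x hx).ne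
    have e1 : ∀ i, pd i (F i) x - F i x ^ 2 =
        (-(1 / 2) * (φ x)⁻¹) * pd i (pd i φ) x + (1 / 4 * (φ x ^ 2)⁻¹) * pd i φ x ^ 2 := by
      intro i
      have d1 : HasFDerivAt φ (fderiv ℝ φ x) x := ((hφ1.differentiable one_ne_zero) x).hasFDerivAt
      have d2 : HasFDerivAt (pd i φ) (fderiv ℝ (pd i φ) x) x :=
        (((hpd1 i).differentiable one_ne_zero) x).hasFDerivAt
      have d3 : HasFDerivAt (fun x => (φ x)⁻¹) (-(φ x ^ 2)⁻¹ • fderiv ℝ φ x) x := 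
        (hasDerivAt_inv hne).comp_hasFDerivAt x d1
      have d4 := (d2.const_mul (-(1/2))).fun_mul d3
      have : pd i (F i) x = (-(1 / 2) * (φ x)⁻¹) * pd i (pd i φ) x
          + (1 / 2 * (φ x ^ 2)⁻¹) * pd i φ x ^ 2 := by
        rw [hF]; simp only
        rw [show ∀ g : EuclideanSpace ℝ (Fin N) → ℝ, pd i g x =
          fderiv ℝ g x (EuclideanSpace.single i 1) from fun _ => rfl, d4.fderiv]
        simp [← pd.eq_def]
        ring
      rw [this, hF]
      field_simp
      ring
    rw [Finset.sum_congr rfl fun i _ => e1 i, Finset.sum_add_distrib, ← Finset.mul_sum,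
      ← Finset.mul_sum]
    have b1 : m ≤ (∑ i, pd i φ x ^ 2) + φ x ^ 2 := hmin (subset_closure hx)
    have b2 : |∑ i, pd i (pd i φ) x| ≤ A := by
      have := hA0 x (subset_closure hx)
      rw [Real.norm_eq_abs] at this
      exact this.trans (le_abs_self _)
    generalize (∑ i, pd i φ x ^ 2) = S at *
    generalize (∑ i, pd i (pd i φ) x) = T at *
    generalize φ x = f at *
    have hf2 : 0 < f ^ 2 := by positivity
    have b3 : |f * T| ≤ A * |f| := by
      rw [abs_mul, mul_comm]; exact mul_le_mul_of_nonneg_right b2 (abs_nonneg _)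
    have b4 : f * T ≤ A * |f| := (le_abs_self _).trans b3
    have b5 : A * |f| / 2 ≤ m / 8 + A ^ 2 / (2 * m) * f ^ 2 := by
      have : 0 ≤ (m / 2 - A * |f|) ^ 2 / (2 * m) := by positivity
      have e : (m / 2 - A * |f|) ^ 2 / (2 * m) = m / 8 + A ^ 2 / (2 * m) * f ^ 2 - A * |f| / 2 := by
        rw [← sq_abs f]; field_simp; ring
      linarith
    have e2 : -(1 / 2) * f⁻¹ * T + 1 / 4 * (f ^ 2)⁻¹ * S - (m / 8 * (f ^ 2)⁻¹ - C0) =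
        (-(1 / 2) * (f * T) + 1 / 4 * S - m / 8 + C0 * f ^ 2) * (f ^ 2)⁻¹ := by
      field_simp
      ring
    have : 0 ≤ (-(1 / 2) * (f * T) + 1 / 4 * S - m / 8 + C0 * f ^ 2) * (f ^ 2)⁻¹ := by
      refine mul_nonneg ?_ (by positivity)
      rw [hC0]
      nlinarith
    linarith
  refine ⟨L ^ 2 * (8 / m) * (1 + C0), by positivity, ?_⟩
  intro w hw hc hs
  have hwc := hw.continuous
  have i1 : Integrable (fun x => w x ^ 2) :=
    intK hc hΩo hs (fun x hx => by simp [u_zero hx]) (by fun_prop)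
  have i2 : Integrable (fun x => (φ x ^ 2)⁻¹ * w x ^ 2) :=
    intK hc hΩo hs (fun x hx => by simp [u_zero hx])
      (((hφc.pow 2).continuousOn.inv₀ fun x hx => pow_ne_zero _ (hlt x hx).ne).mul
        (hwc.pow 2).continuousOn)
  have i3 : Integrable (fun x => (bdist Ω x ^ 2)⁻¹ * w x ^ 2) :=
    intK hc hΩo hs (fun x hx => by simp [u_zero hx])
      ((((bdist_cont Ω).pow 2).continuousOn.inv₀ fun x hx =>
        pow_ne_zero _ (bdist_pos hN hΩo hΩb h0 hx).ne').mul (hwc.pow 2).continuousOn)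
  have i4 : Integrable (fun x => (∑ i, (pd i (F i) x - F i x ^ 2)) * w x ^ 2) :=
    intK hc hΩo hs (fun x hx => by simp [u_zero hx])
      ((continuousOn_finsetSum _ fun i _ => (pd_contOn hΩo (hFc i) i).sub
        ((hFc i).continuousOn.pow 2)).mul (hwc.pow 2).continuousOn)
  have k1 := vf hw hc hΩo hs hFc
  have k2 : 0 ≤ ∫ x, ∑ i, (pd i w x + F i x * w x) ^ 2 :=
    integral_nonneg fun x => Finset.sum_nonneg fun i _ => sq_nonneg _
  have k3 : m / 8 * (∫ x, (φ x ^ 2)⁻¹ * w x ^ 2) - C0 * (∫ x, w x ^ 2) ≤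
      ∫ x, (∑ i, (pd i (F i) x - F i x ^ 2)) * w x ^ 2 := by
    rw [← integral_const_mul, ← integral_const_mul,
      ← integral_sub (i2.const_mul _) (i1.const_mul _)]
    refine integral_mono ((i2.const_mul _).sub (i1.const_mul _)) i4 fun x => ?_
    simp only
    by_cases hx : x ∈ tsupport w
    · have := mul_le_mul_of_nonneg_right (hdiv x (hs hx)) (sq_nonneg (w x))
      linarith
    · simp [u_zero hx]
  have k4 : ∫ x, (bdist Ω x ^ 2)⁻¹ * w x ^ 2 ≤ L ^ 2 * ∫ x, (φ x ^ 2)⁻¹ * w x ^ 2 := by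
    rw [← integral_const_mul]
    refine integral_mono i3 (i2.const_mul _) fun x => ?_
    simp only
    by_cases hx : x ∈ tsupport w
    · rw [← mul_assoc]
      refine mul_le_mul_of_nonneg_right ?_ (sq_nonneg _)
      have hd := bdist_pos hN hΩo hΩb h0 (hs hx)
      have h1 := hLd x (hs hx)
      have h2 : φ x ^ 2 ≤ L ^ 2 * bdist Ω x ^ 2 := by
        rw [← sq_abs, ← mul_pow]; gcongr
      have h3 : 0 < φ x ^ 2 := by have := (hlt x (hs hx)).ne; positivity
      rw [← div_eq_mul_inv, le_div_iff₀ h3, inv_mul_le_iff₀ (by positivity)]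
      linarith
    · simp [u_zero hx]
  have P0 : 0 ≤ ∫ x, ∑ i, pd i w x ^ 2 :=
    integral_nonneg fun x => Finset.sum_nonneg fun i _ => sq_nonneg _
  have W0 : 0 ≤ ∫ x, w x ^ 2 := integral_nonneg fun x => sq_nonneg _
  generalize (∫ x, ∑ i, pd i w x ^ 2) = P at *
  generalize (∫ x, w x ^ 2) = W at *
  generalize (∫ x, (φ x ^ 2)⁻¹ * w x ^ 2) = Z at *
  have k5 : m / 8 * Z ≤ (1 + C0) * (P + W) := by nlinarith
  have k6 : Z ≤ 8 / m * ((1 + C0) * (P + W)) := by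
    have := mul_le_mul_of_nonneg_left k5 (by positivity : 0 ≤ 8 / m)
    have e : 8 / m * (m / 8 * Z) = Z := by field_simp
    linarith
  calc _ ≤ _ := k4
    _ ≤ L ^ 2 * (8 / m * ((1 + C0) * (P + W))) := by gcongr
    _ = _ := by ring

lemma D1 {N : ℕ} (hN : 3 ≤ N) {Ω : Set (EuclideanSpace ℝ (Fin N))} (hΩo : IsOpen Ω)
    (hΩb : Bornology.IsBounded Ω) (h0 : (0 : EuclideanSpace ℝ (Fin N)) ∈ Ω)
    (hΩ : IsC2Domain Ω) : ∃ C : ℝ, 0 < C ∧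
    ∀ u : EuclideanSpace ℝ (Fin N) → ℝ, ContDiff ℝ 1 u → HasCompactSupport u →
      tsupport u ⊆ Ω \ {0} → (∀ x, 0 ≤ u x) →
      (∫ x, u x ^ 2) ≤ C * hQ ((N - 2) / 2) u ∧
      (∫ x, (bdist Ω x ^ 2)⁻¹ * u x ^ 2) ≤ C * hQ ((N - 2) / 2) u ∧
      (∫ x, ‖x‖ ^ 2 * u x ^ (2 * N / (N - 2) : ℝ)) ≤
        (C * hQ ((N - 2) / 2) u) ^ (N / (N - 2) : ℝ) := by
  have hN3 : (3 : ℝ) ≤ N := by exact_mod_cast hN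
  have hN2 : (0 : ℝ) < N - 2 := by linarith
  have hN0 : (0 : ℝ) < N := by linarith
  set h : ℝ := (N - 2) / 2 with hh
  set a : ℝ := (N - 2) / N with ha
  have ha0 : 0 < a := by positivity
  have ha1 : a < 1 := by rw [ha, div_lt_one hN0]; linarith
  obtain ⟨R0, hR0⟩ := hΩb.subset_closedBall (0 : EuclideanSpace ℝ (Fin N))
  set R := |R0| + 1 with hR
  have hRp : 0 < R := by positivity
  have hRb : ∀ x ∈ Ω, ‖x‖ ≤ R := fun x hx => by
    have := hR0 hx
    rw [mem_closedBall_zero_iff] at this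
    linarith [le_abs_self R0]
  obtain ⟨CH, hCH, HH⟩ := hardy (N := N) h a R (by rw [hh]; ring) ha0 hRp
  obtain ⟨CB, hCB, HB⟩ := bdry_hardy hN hΩo hΩb h0 hΩ
  obtain ⟨CS, hCS, HS⟩ := sobolev N hN
  set ρ := bdist Ω 0 / 2 with hρ
  have hd0 := bdist_pos hN hΩo hΩb h0 h0
  have hρp : 0 < ρ := by positivity
  set C1 := R ^ (2 - 2 * a) * CH with hC1
  have hC1p : 0 < C1 := by positivity
  set C2 := ρ ^ (-(2 * a)) * (CB * (CH + R ^ (2 * a) * C1)) + (ρ ^ 2)⁻¹ * C1 with hC2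
  have hC2p : 0 < C2 := by positivity
  refine ⟨C1 + C2 + CS * CH, by positivity, ?_⟩
  intro u hu hc hs hu0
  have hsΩ : tsupport u ⊆ Ω := fun x hx => (hs hx).1
  have hs0 : tsupport u ⊆ {0}ᶜ := fun x hx => (hs hx).2
  obtain ⟨h1, h2⟩ := HH u hu hc hs0 (fun x hx => hRb x (hsΩ hx))
  obtain ⟨w1, w2⟩ := w_props a hu hs0
  set w : EuclideanSpace ℝ (Fin N) → ℝ := fun x => ‖x‖ ^ a * u x with hw
  set Q := hQ h u with hQdef
  have huc := hu.continuous
  have hwc := w1.continuous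
  have c2 := rp_contOn (N := N) (2 * a - 2)
  have i0 : Integrable (fun x => u x ^ 2) :=
    intK hc hΩo hsΩ (fun x hx => by simp [u_zero hx]) (by fun_prop)
  have i1 : Integrable (fun x => ‖x‖ ^ (2 * a - 2) * u x ^ 2) :=
    intK hc isOpen_compl_singleton hs0 (fun x hx => by simp [u_zero hx])
      (c2.mul (huc.continuousOn.pow 2))
  have cd : ContinuousOn (fun x => (bdist Ω x ^ 2)⁻¹) Ω :=
    ((bdist_cont Ω).pow 2).continuousOn.inv₀ fun x hx =>
        pow_ne_zero _ (bdist_pos hN hΩo hΩb h0 hx).ne'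
  have i2 : Integrable (fun x => (bdist Ω x ^ 2)⁻¹ * u x ^ 2) :=
    intK hc hΩo hsΩ (fun x hx => by simp [u_zero hx]) (cd.mul (huc.pow 2).continuousOn)
  have i3 : Integrable (fun x => (bdist Ω x ^ 2)⁻¹ * w x ^ 2) :=
    intK hc hΩo hsΩ (fun x hx => by simp [hw, u_zero hx]) (cd.mul (hwc.pow 2).continuousOn)
  have i4 : Integrable (fun x => w x ^ 2) :=
    intK hc hΩo hsΩ (fun x hx => by simp [hw, u_zero hx]) (by fun_prop)
  have Z0 : 0 ≤ ∫ x, ‖x‖ ^ (2 * a - 2) * u x ^ 2 := integral_nonneg fun x => by positivity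
  have Q0 : 0 ≤ Q := nonneg_of_mul_nonneg_right (Z0.trans h1) hCH
  have wsq : ∀ x, w x ^ 2 = ‖x‖ ^ (2 * a) * u x ^ 2 := by
    intro x
    rw [hw]; simp only
    rw [mul_pow, ← Real.rpow_natCast, ← Real.rpow_mul (norm_nonneg _)]
    congr 2; push_cast; ring
  have A1 : (∫ x, u x ^ 2) ≤ C1 * Q := by
    have : (∫ x, u x ^ 2) ≤ ∫ x, R ^ (2 - 2 * a) * (‖x‖ ^ (2 * a - 2) * u x ^ 2) := by
      refine integral_mono i0 (i1.const_mul _) fun x => ?_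
      simp only
      by_cases hx : x ∈ tsupport u
      · have hn : 0 < ‖x‖ := norm_pos_iff.2 (hs0 hx)
        have : R ^ (2 * a - 2) ≤ ‖x‖ ^ (2 * a - 2) :=
          Real.rpow_le_rpow_of_nonpos hn (hRb x (hsΩ hx)) (by linarith)
        have e : R ^ (2 - 2 * a) * R ^ (2 * a - 2) = 1 := by
          rw [← Real.rpow_add hRp]; simp
        have e2 : 1 ≤ R ^ (2 - 2 * a) * ‖x‖ ^ (2 * a - 2) := by
          rw [← e]; gcongr
        rw [← mul_assoc]
        exact le_mul_of_one_le_left (sq_nonneg _) e2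
      · simp [u_zero hx]
    rw [integral_const_mul] at this
    refine this.trans ?_
    rw [hC1, mul_assoc]
    gcongr
  have A2 : (∫ x, w x ^ 2) ≤ R ^ (2 * a) * (C1 * Q) := by
    have : (∫ x, w x ^ 2) ≤ ∫ x, R ^ (2 * a) * u x ^ 2 := by
      refine integral_mono i4 (i0.const_mul _) fun x => ?_
      simp only [wsq]
      by_cases hx : x ∈ tsupport u
      · gcongr
        exact hRb x (hsΩ hx)
      · simp [u_zero hx]
    rw [integral_const_mul] at this
    refine this.trans ?_
    gcongr
  have hcw : HasCompactSupport w := hc.mul_left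
  have A3 := HB w w1 hcw (w2.trans hsΩ)
  have A4 : (∫ x, (bdist Ω x ^ 2)⁻¹ * u x ^ 2) ≤ C2 * Q := by
    have : (∫ x, (bdist Ω x ^ 2)⁻¹ * u x ^ 2) ≤
        ρ ^ (-(2 * a)) * (∫ x, (bdist Ω x ^ 2)⁻¹ * w x ^ 2) + (ρ ^ 2)⁻¹ * ∫ x, u x ^ 2 := by
      rw [← integral_const_mul, ← integral_const_mul,
        ← integral_add (i3.const_mul _) (i0.const_mul _)]
      refine integral_mono i2 ((i3.const_mul _).add (i0.const_mul _)) fun x => ?_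
      simp only
      by_cases hx : x ∈ tsupport u
      · have hd := bdist_pos hN hΩo hΩb h0 (hsΩ hx)
        by_cases hxρ : ‖x‖ ≤ ρ
        · have l1 : bdist Ω 0 ≤ bdist Ω x + dist 0 x := Metric.infDist_le_infDist_add_dist
          rw [dist_zero_left] at l1
          have l2 : ρ ≤ bdist Ω x := by linarith
          have : (bdist Ω x ^ 2)⁻¹ * u x ^ 2 ≤ (ρ ^ 2)⁻¹ * u x ^ 2 := by gcongr
          have : 0 ≤ ρ ^ (-(2 * a)) * ((bdist Ω x ^ 2)⁻¹ * w x ^ 2) := by positivity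
          linarith
        · push Not at hxρ
          have e : 1 ≤ ρ ^ (-(2 * a)) * ‖x‖ ^ (2 * a) := by
            have : ρ ^ (-(2 * a)) * ρ ^ (2 * a) = 1 := by rw [← Real.rpow_add hρp]; simp
            rw [← this]; gcongr
          have e2 : u x ^ 2 ≤ ρ ^ (-(2 * a)) * w x ^ 2 := by
            rw [wsq, ← mul_assoc]
            exact le_mul_of_one_le_left (sq_nonneg _) e
          have e3 : (bdist Ω x ^ 2)⁻¹ * u x ^ 2 ≤
              (bdist Ω x ^ 2)⁻¹ * (ρ ^ (-(2 * a)) * w x ^ 2) := by gcongr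
          have : 0 ≤ (ρ ^ 2)⁻¹ * u x ^ 2 := by positivity
          linarith
      · simp [u_zero hx, hw]
    refine this.trans ?_
    calc _ ≤ ρ ^ (-(2 * a)) * (CB * (CH * Q + R ^ (2 * a) * (C1 * Q))) + (ρ ^ 2)⁻¹ * (C1 * Q) := by
          gcongr
          exact A3.trans (by gcongr)
      _ = C2 * Q := by rw [hC2]; ring
  have hw0 : ∀ x, 0 ≤ w x := fun x => mul_nonneg (by positivity) (hu0 x)
  have A5 := HS w w1 hcw hw0
  have e5 : ∀ x, w x ^ (2 * N / (N - 2) : ℝ) = ‖x‖ ^ 2 * u x ^ (2 * N / (N - 2) : ℝ) := by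
    intro x
    rw [hw]; simp only
    rw [Real.mul_rpow (by positivity) (hu0 x), ← Real.rpow_mul (norm_nonneg _)]
    congr 1
    rw [ha, ← Real.rpow_natCast]; congr 1; push_cast; field_simp
  simp only [e5] at A5
  refine ⟨A1.trans ?_, A4.trans ?_, A5.trans ?_⟩
  · gcongr; have : 0 < CS * CH := by positivity
    linarith
  · gcongr; have : 0 < CS * CH := by positivity
    linarith
  · have P0 : 0 ≤ ∫ x, ∑ i, pd i w x ^ 2 :=
      integral_nonneg fun x => Finset.sum_nonneg fun i _ => sq_nonneg _
    refine Real.rpow_le_rpow (by positivity) ?_ (by positivity)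
    calc _ ≤ CS * (CH * Q) := by gcongr
      _ = CS * CH * Q := by ring
      _ ≤ _ := by gcongr; linarith

lemma log_lin {t y : ℝ} (ht : 0 < t) (hy : 0 < y) : Real.log y ≤ t * y - 1 - Real.log t := by
  have := Real.log_le_sub_one_of_pos (mul_pos ht hy)
  rw [Real.log_mul ht.ne' hy.ne'] at this
  linarith

/-- Logarithmic Hardy–Sobolev inequality for the Schrödinger operator with critical
singularity at the origin. -/
theorem log_hardy_sobolev
    (N : ℕ) (hN : 3 ≤ N)
    (Ω : Set (EuclideanSpace ℝ (Fin N))) (hΩo : IsOpen Ω) (hΩconn : IsConnected Ω)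
    (hΩb : Bornology.IsBounded Ω) (hΩsm : IsC2Domain Ω)
    (h0 : (0 : EuclideanSpace ℝ (Fin N)) ∈ Ω) :
    ∃ K₃ : ℝ, 0 < K₃ ∧
      ∀ u : EuclideanSpace ℝ (Fin N) → ℝ,
        ContDiff ℝ (⊤ : ℕ∞) u → HasCompactSupport u →
        tsupport u ⊆ Ω \ {0} → (∀ x, 0 ≤ u x) → u ≠ 0 →
        ∀ ε : ℝ, 0 < ε →
        (∫ x in Ω, u x ^ 2 *
            Real.log (u x / ((∫ y in Ω, u y ^ 2) ^ ((1 : ℝ) / 2) *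
              ‖x‖ ^ ((2 - (N : ℝ)) / 2) * bdist Ω x))) ≤
          ε * (∫ x in Ω, (‖gradient u x‖ ^ 2 -
              ((N : ℝ) - 2) ^ 2 / (4 * ‖x‖ ^ 2) * u x ^ 2)) +
            (K₃ - ((N : ℝ) + 2) / 4 * Real.log ε) * ∫ x in Ω, u x ^ 2 := by
  obtain ⟨C, hC, H⟩ := D1 hN hΩo hΩb h0 hΩsm
  have hN3 : (3 : ℝ) ≤ N := by exact_mod_cast hN
  have hN2 : (0 : ℝ) < N - 2 := by linarith
  have hN0 : (0 : ℝ) < N := by linarith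
  set k := -(N / 4 * (1 + Real.log (2 / (N * C)))) - 1 / 2 * (1 - Real.log C) with hk
  refine ⟨|k| + 1, by positivity, ?_⟩
  intro u hu' hc hs hu0 hune ε hε
  have hu : ContDiff ℝ 1 u := hu'.of_le (by exact_mod_cast le_top)
  have huc := hu.continuous
  have hsΩ : tsupport u ⊆ Ω := fun x hx => (hs hx).1
  have hs0 : tsupport u ⊆ {0}ᶜ := fun x hx => (hs hx).2
  obtain ⟨H1, H2, H3⟩ := H u hu hc hs hu0
  have full : ∀ f : EuclideanSpace ℝ (Fin N) → ℝ, (∀ x, x ∉ tsupport u → f x = 0) →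
      ∫ x in Ω, f x = ∫ x, f x := fun f hf =>
    setIntegral_eq_integral_of_forall_compl_eq_zero fun x hx => hf x fun h => hx (hsΩ h)
  have fullA : ∫ x in Ω, u x ^ 2 = ∫ x, u x ^ 2 := full _ fun x hx => by simp [u_zero hx]
  have i0 : Integrable (fun x => u x ^ 2) :=
    intK hc hΩo hsΩ (fun x hx => by simp [u_zero hx]) (by fun_prop)
  set h : ℝ := (N - 2) / 2 with hh
  have hhp : 0 < h := by positivity
  have hNh : (N : ℝ) = 2 * h + 2 := by rw [hh]; ring
  have fullQ : (∫ x in Ω, (‖gradient u x‖ ^ 2 -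
              ((N : ℝ) - 2) ^ 2 / (4 * ‖x‖ ^ 2) * u x ^ 2)) = hQ h u := by
    rw [full _ fun x hx => by rw [norm_gradient_sq]; simp [u_zero hx, pd_zero _ hx], hQ,
      ← integral_sub]
    · refine integral_congr_ae (Filter.Eventually.of_forall fun x => ?_)
      simp only
      rw [norm_gradient_sq, Real.rpow_neg (norm_nonneg _), hh, Real.rpow_ofNat]
      congr 2
      rw [div_pow, div_mul_eq_div_mul_one_div]; norm_num
    · exact intK hc hΩo hsΩ (fun x hx => by simp [pd_zero _ hx])
        (continuousOn_finsetSum _ fun i _ => ((pd_cont hu i).continuousOn.pow 2))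
    · exact intK hc isOpen_compl_singleton hs0 (fun x hx => by simp [u_zero hx])
        ((continuousOn_const.mul (rp_contOn (-2))).mul (huc.continuousOn.pow 2))
  rw [fullQ, fullA, full _ fun x hx => by simp [u_zero hx]]
  set A := ∫ x, u x ^ 2 with hA
  set Q := hQ h u with hQd
  have hAp : 0 < A := by
    obtain ⟨x, hx⟩ := Function.ne_iff.1 hune
    refine (huc.pow 2).integral_pos_of_hasCompactSupport_nonneg_nonzero ?_ (fun x => sq_nonneg _)
      (x := x) (pow_ne_zero 2 hx)
    exact HasCompactSupport.intro hc fun x hx => by simp [u_zero hx]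
  have hQp : 0 < Q := by
    by_contra hneg
    push Not at hneg
    have := mul_nonpos_of_nonneg_of_nonpos hC.le hneg
    linarith
  set q := C * Q / A with hq
  have hqp : 0 < q := by positivity
  set t := q ^ (-(1 + 1 / h)) with ht
  have htp : 0 < t := by positivity
  set s := 2 * ε / (N * C) with hs'
  have hsp : 0 < s := by positivity
  set τ := ε / C with hτ
  have hτp : 0 < τ := by positivity
  have hN2h : (N : ℝ) - 2 = 2 * h := by rw [hh]; ring
  have e2 : (2 * N / (N - 2) : ℝ) = 2 + 2 / h := by rw [hN2h, hNh]; field_simp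
  have e3 : (N / (N - 2) : ℝ) = 1 + 1 / h := by rw [hN2h, hNh]; field_simp
  rw [e3] at H3
  rw [e2] at H3
  set M := ∫ x, ‖x‖ ^ 2 * u x ^ (2 + 2 / h) with hM
  set B := ∫ x, (bdist Ω x ^ 2)⁻¹ * u x ^ 2 with hB
  have hdc : ContinuousOn (fun x => (bdist Ω x ^ 2)⁻¹) Ω :=
    ((bdist_cont Ω).pow 2).continuousOn.inv₀ fun x hx =>
        pow_ne_zero _ (bdist_pos hN hΩo hΩb h0 hx).ne'
  have iB : Integrable (fun x => (bdist Ω x ^ 2)⁻¹ * u x ^ 2) :=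
    intK hc hΩo hsΩ (fun x hx => by simp [u_zero hx]) (hdc.mul (huc.pow 2).continuousOn)
  have iM : Integrable (fun x => ‖x‖ ^ 2 * u x ^ (2 + 2 / h)) :=
    intK hc hΩo hsΩ (fun x hx => by
        rw [u_zero hx, Real.zero_rpow (by positivity), mul_zero])
      ((continuous_norm.pow 2).mul (huc.rpow_const fun x => Or.inr (by positivity))).continuousOn
  -- decomposition of the logarithm
  have hlog : ∀ x, u x ^ 2 * Real.log (u x / (A ^ ((1 : ℝ) / 2) *
              ‖x‖ ^ ((2 - (N : ℝ)) / 2) * bdist Ω x)) =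
      u x * (u x * Real.log (u x)) - (1 / 2 * Real.log A) * u x ^ 2
        + h * (u x ^ 2 * Real.log ‖x‖) - u x ^ 2 * Real.log (bdist Ω x) := by
    intro x
    by_cases hx : u x = 0
    · simp [hx]
    · have hxs : x ∈ tsupport u := subset_tsupport _ hx
      have hn : 0 < ‖x‖ := norm_pos_iff.2 (hs0 hxs)
      have hd := bdist_pos hN hΩo hΩb h0 (hsΩ hxs)
      rw [Real.log_div hx (by positivity), Real.log_mul (by positivity) hd.ne',
        Real.log_mul (by positivity) (by positivity), Real.log_rpow hAp, Real.log_rpow hn]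
      rw [hh]; ring
  have iL : Integrable (fun x => u x ^ 2 * Real.log (u x / (A ^ ((1 : ℝ) / 2) *
              ‖x‖ ^ ((2 - (N : ℝ)) / 2) * bdist Ω x))) := by
    simp_rw [hlog]
    have hUo : IsOpen (Ω \ {0}) := hΩo.sdiff isClosed_singleton
    refine intK hc hUo hs (fun x hx => by simp [u_zero hx]) ?_
    have k1 : ContinuousOn (fun x => u x * Real.log (u x)) (Ω \ {0}) :=
      (Real.continuous_mul_log.comp huc).continuousOn
    have k2 : ContinuousOn (fun x : EuclideanSpace ℝ (Fin N) => Real.log ‖x‖) (Ω \ {0}) :=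
      continuous_norm.continuousOn.log fun x hx => norm_ne_zero_iff.2 hx.2
    have k3 : ContinuousOn (fun x : EuclideanSpace ℝ (Fin N) => Real.log (bdist Ω x)) (Ω \ {0}) :=
      (bdist_cont Ω).continuousOn.log fun x hx => (bdist_pos hN hΩo hΩb h0 hx.1).ne'
    fun_prop
  have hpt : ∀ x, u x ^ 2 * Real.log (u x / (A ^ ((1 : ℝ) / 2) *
              ‖x‖ ^ ((2 - (N : ℝ)) / 2) * bdist Ω x)) ≤
      (h / 2 * t * A ^ (-(1 / h))) * (‖x‖ ^ 2 * u x ^ (2 + 2 / h)) +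
      (τ / 2) * ((bdist Ω x ^ 2)⁻¹ * u x ^ 2) +
      (-(h / 2 * (1 + Real.log t)) - 1 / 2 * (1 + Real.log τ)) * u x ^ 2 := by
    intro x
    by_cases hx : u x = 0
    · rw [hx, Real.zero_rpow (by positivity)]; simp
    · have hxs : x ∈ tsupport u := subset_tsupport _ hx
      have hup : 0 < u x := lt_of_le_of_ne (hu0 x) (Ne.symm hx)
      have hn : 0 < ‖x‖ := norm_pos_iff.2 (hs0 hxs)
      have hd := bdist_pos hN hΩo hΩb h0 (hsΩ hxs)
      have l1 := log_lin hτp (y := (bdist Ω x ^ 2)⁻¹) (by positivity)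
      have l2 := log_lin htp (y := u x ^ (2 / h) * ‖x‖ ^ 2 * A ^ (-(1 / h))) (by positivity)
      rw [Real.log_inv, Real.log_pow] at l1
      rw [Real.log_mul (by positivity) (by positivity), Real.log_mul (by positivity) (by positivity),
        Real.log_rpow hup, Real.log_rpow hAp, Real.log_pow] at l2
      push_cast at l1 l2
      have e4 : h / 2 * (2 / h * Real.log (u x) + 2 * Real.log ‖x‖ + -(1 / h) * Real.log A) =
          Real.log (u x) + h * Real.log ‖x‖ - 1 / 2 * Real.log A := by field_simp; ring
      have e5 : u x ^ (2 + 2 / h) = u x ^ 2 * u x ^ (2 / h) := by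
        rw [Real.rpow_add hup, Real.rpow_ofNat]
      have l3 := mul_le_mul_of_nonneg_left l2 (by positivity : 0 ≤ h / 2)
      rw [e4] at l3
      have l4 := mul_le_mul_of_nonneg_left (add_le_add l3
        (mul_le_mul_of_nonneg_left l1 (by norm_num : (0:ℝ) ≤ 1 / 2))) (sq_nonneg (u x))
      rw [hlog, e5]
      linarith
  have hmono := integral_mono iL (((iM.const_mul _).add (iB.const_mul _)).add (i0.const_mul _)) hpt
  have hsum : ∫ x, ((h / 2 * t * A ^ (-(1 / h))) * (‖x‖ ^ 2 * u x ^ (2 + 2 / h)) +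
      (τ / 2) * ((bdist Ω x ^ 2)⁻¹ * u x ^ 2) +
      (-(h / 2 * (1 + Real.log t)) - 1 / 2 * (1 + Real.log τ)) * u x ^ 2) =
      (h / 2 * t * A ^ (-(1 / h))) * M + (τ / 2) * B +
      (-(h / 2 * (1 + Real.log t)) - 1 / 2 * (1 + Real.log τ)) * A := by
    have iMB : Integrable (fun x => (h / 2 * t * A ^ (-(1 / h))) * (‖x‖ ^ 2 * u x ^ (2 + 2 / h)) +
      (τ / 2) * ((bdist Ω x ^ 2)⁻¹ * u x ^ 2)) := (iM.const_mul _).add (iB.const_mul _)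
    rw [integral_add iMB (i0.const_mul _), integral_add (iM.const_mul _) (iB.const_mul _),
      integral_const_mul, integral_const_mul, integral_const_mul]
  refine (hmono.trans_eq hsum).trans ?_
  have f1 : t * A ^ (-(1 / h)) * (C * Q) ^ (1 + 1 / h) = A := by
    have : C * Q = q * A := by rw [hq]; field_simp
    rw [this, Real.mul_rpow hqp.le hAp.le, ht]
    have g1 : q ^ (-(1 + 1 / h)) * q ^ (1 + 1 / h) = 1 := by rw [← Real.rpow_add hqp]; simp
    have g2 : A ^ (-(1 / h)) * A ^ (1 + 1 / h) = A := by
      rw [← Real.rpow_add hAp]; simp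
    calc _ = (q ^ (-(1 + 1 / h)) * q ^ (1 + 1 / h)) * (A ^ (-(1 / h)) * A ^ (1 + 1 / h)) := by ring
      _ = A := by rw [g1, g2, one_mul]
  have f2 : (h / 2 * t * A ^ (-(1 / h))) * M ≤ h / 2 * A := by
    calc _ ≤ (h / 2 * t * A ^ (-(1 / h))) * (C * Q) ^ (1 + 1 / h) := by gcongr
      _ = h / 2 * (t * A ^ (-(1 / h)) * (C * Q) ^ (1 + 1 / h)) := by ring
      _ = h / 2 * A := by rw [f1]
  have f3 : (τ / 2) * B ≤ ε / 2 * Q := by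
    calc _ ≤ τ / 2 * (C * Q) := by gcongr
      _ = _ := by rw [hτ]; field_simp
  have f4 : Real.log t = -(1 + 1 / h) * Real.log q := by rw [ht, Real.log_rpow hqp]
  have f5 : -(h / 2 * (1 + Real.log t)) = -(h / 2) + N / 4 * Real.log q := by
    rw [f4, hNh]; field_simp; ring
  have f6 := log_lin hsp hqp
  have f7 : N / 4 * (s * q) * A = ε / 2 * Q := by
    rw [hs', hq]; field_simp; ring
  have f8 : Real.log s = Real.log (2 / (N * C)) + Real.log ε := by
    rw [← Real.log_mul (by positivity) hε.ne', hs']; congr 1; ring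
  have f9 : Real.log τ = Real.log ε - Real.log C := by rw [hτ, Real.log_div hε.ne' hC.ne']
  have f10 := mul_le_mul_of_nonneg_right
    (mul_le_mul_of_nonneg_left f6 (by positivity : (0:ℝ) ≤ N / 4)) hAp.le
  have f11 : k * A ≤ (|k| + 1) * A := by
    gcongr; linarith [le_abs_self k]
  have f12 : k * A = (-(N / 4 * (1 + Real.log (2 / (N * C)))) - 1 / 2 * (1 - Real.log C)) * A := by
    rw [hk]
  rw [f5, f9]
  rw [f8] at f10
  linarith
end
end

section
/- Let N ≥ 3 and let Ω ⊂ ℝ^N be a smooth bounded domain containing the origin. Then there exists a positive constant C such that for every v ∈ C₀^∞(Ω), ∫_Ω |∇v(x)|² · |x|^{2−N} dx ≥ C · ( ∫_Ω |v(x)|^{2N/(N−2)} · |x|^{2−N} dx )^{(N−2)/N}. -/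
open MeasureTheory Real

noncomputable section

/-- Regularised power weight. -/
def HSW {N : ℕ} (e a : ℝ) (x : EuclideanSpace ℝ (Fin N)) : ℝ := (‖x‖ ^ 2 + e) ^ a

lemma HSW_pos {N : ℕ} {e : ℝ} (he : 0 < e) (a : ℝ) (x : EuclideanSpace ℝ (Fin N)) :
    0 < HSW e a x := by unfold HSW; positivity

lemma HSW_hasFDerivAt {N : ℕ} {e : ℝ} (he : 0 < e) (a : ℝ) (x : EuclideanSpace ℝ (Fin N)) :
    HasFDerivAt (HSW e a) ((2 * a * HSW e (a - 1) x) • innerSL ℝ x) x := by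
  have h1 : HasFDerivAt (fun y : EuclideanSpace ℝ (Fin N) => ‖y‖ ^ 2 + e)
      (2 • innerSL ℝ x) x := (hasStrictFDerivAt_norm_sq x).hasFDerivAt.add_const e
  have h2 := h1.rpow_const (p := a) (Or.inl (by positivity : ‖x‖ ^ 2 + e ≠ 0))
  have h3 : (2 * a * HSW e (a - 1) x) • innerSL ℝ x =
      (a * (‖x‖ ^ 2 + e) ^ (a - 1)) • (2 • innerSL ℝ x) := by
    ext y
    simp [HSW]
    ring
  rw [h3]
  exact h2

lemma HSW_contDiff {N : ℕ} {e : ℝ} (he : 0 < e) (a : ℝ) :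
    ContDiff ℝ 1 (HSW (N := N) e a) := by
  unfold HSW
  exact ContDiff.rpow_const_of_ne ((contDiff_norm_sq ℝ).add contDiff_const)
    (fun x => by positivity)

lemma HSW_continuous {N : ℕ} {e : ℝ} (he : 0 < e) (a : ℝ) :
    Continuous (HSW (N := N) e a) := (HSW_contDiff he a).continuous

lemma HSW_norm_mul {N : ℕ} {e : ℝ} (he : 0 < e) (a : ℝ) (x : EuclideanSpace ℝ (Fin N)) :
    ‖x‖ * HSW e (a - 1/2) x ≤ HSW e a x := by
  have hq : 0 < ‖x‖ ^ 2 + e := by positivity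
  have h1 : ‖x‖ ≤ (‖x‖ ^ 2 + e) ^ (1/2 : ℝ) := by
    rw [← Real.sqrt_eq_rpow]
    apply Real.le_sqrt_of_sq_le
    linarith
  calc ‖x‖ * HSW e (a - 1/2) x ≤ (‖x‖ ^ 2 + e) ^ (1/2 : ℝ) * HSW e (a - 1/2) x := by
        gcongr; exact (HSW_pos he _ x).le
    _ = HSW e a x := by
        unfold HSW; rw [← Real.rpow_add hq]; congr 1; ring

lemma HSW_sq_mul {N : ℕ} {e : ℝ} (he : 0 < e) (a : ℝ) (x : EuclideanSpace ℝ (Fin N)) :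
    ‖x‖ ^ 2 * HSW e (a - 1) x ≤ HSW e a x := by
  have hq : 0 < ‖x‖ ^ 2 + e := by positivity
  calc ‖x‖ ^ 2 * HSW e (a - 1) x ≤ (‖x‖ ^ 2 + e) * HSW e (a - 1) x := by
        have := (HSW_pos he (a-1) x).le
        gcongr; linarith
    _ = HSW e a x := by
        unfold HSW; rw [Real.rpow_sub_one hq.ne']; field_simp

lemma HS_hardy {N : ℕ} (hN : 3 ≤ N) {e : ℝ} (he : 0 < e)
    (f : EuclideanSpace ℝ (Fin N) → ℝ) (hf : ContDiff ℝ 1 f) (hc : HasCompactSupport f)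
    (hf0 : ∀ x, 0 ≤ f x) :
    ∫ x, f x * HSW e ((1 - (N:ℝ)) / 2) x ≤
      ∫ x, ‖fderiv ℝ f x‖ * HSW e ((2 - (N:ℝ)) / 2) x := by
  set b : ℝ := (1 - (N:ℝ)) / 2 with hb
  have hfd : Continuous (fderiv ℝ f) := hf.continuous_fderiv one_ne_zero
  have hfdc : HasCompactSupport (fderiv ℝ f) := hc.fderiv ℝ
  let g : Fin N → EuclideanSpace ℝ (Fin N) → ℝ := fun i x => x i * HSW e b x
  have hg : ∀ i, ContDiff ℝ 1 (g i) := fun i => by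
    have : ContDiff ℝ 1 (fun x : EuclideanSpace ℝ (Fin N) => x i) := by fun_prop
    exact this.mul (HSW_contDiff he b)
  have hgd : ∀ i x, fderiv ℝ (g i) x (EuclideanSpace.single i 1) =
      HSW e b x + x i ^ 2 * (2 * b * HSW e (b - 1) x) := by
    intro i x
    have h1 : HasFDerivAt (fun x : EuclideanSpace ℝ (Fin N) => x i)
      (EuclideanSpace.proj i : EuclideanSpace ℝ (Fin N) →L[ℝ] ℝ) x :=
      (EuclideanSpace.proj i : EuclideanSpace ℝ (Fin N) →L[ℝ] ℝ).hasFDerivAt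
    have h2 : fderiv ℝ (g i) x = _ := (h1.mul (HSW_hasFDerivAt he b x)).fderiv
    rw [h2]
    simp [EuclideanSpace.inner_single_right]
    ring
  have i1 : ∀ i, Integrable (fun x => fderiv ℝ f x (EuclideanSpace.single i 1) * g i x) := by
    intro i
    apply Continuous.integrable_of_hasCompactSupport
    · exact (hfd.clm_apply continuous_const).mul (hg i).continuous
    · exact (hc.fderiv_apply ℝ _).mul_right
  have i2 : ∀ i, Integrable (fun x => f x * fderiv ℝ (g i) x (EuclideanSpace.single i 1)) := by
    intro i
    apply Continuous.integrable_of_hasCompactSupport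
    · exact hf.continuous.mul
        (((hg i).continuous_fderiv one_ne_zero).clm_apply continuous_const)
    · exact hc.mul_right
  have ibp : ∀ i, ∫ x, f x * fderiv ℝ (g i) x (EuclideanSpace.single i 1) =
      - ∫ x, fderiv ℝ f x (EuclideanSpace.single i 1) * g i x := by
    intro i
    apply integral_mul_fderiv_eq_neg_fderiv_mul_of_integrable (i1 i) (i2 i)
    · apply Continuous.integrable_of_hasCompactSupport (hf.continuous.mul (hg i).continuous)
      exact hc.mul_right
    · intro x _; exact hf.differentiable one_ne_zero x
    · intro x _; exact (hg i).differentiable one_ne_zero x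
  have key := Finset.sum_congr rfl (fun i (_ : i ∈ Finset.univ) => ibp i)
  rw [Finset.sum_neg_distrib, ← integral_finsetSum _ (fun i _ => i2 i),
    ← integral_finsetSum _ (fun i _ => i1 i), ← integral_neg] at key
  have hR : Integrable (fun x => ‖fderiv ℝ f x‖ * HSW e ((2 - (N:ℝ)) / 2) x) := by
    apply Continuous.integrable_of_hasCompactSupport (hfd.norm.mul (HSW_continuous he _))
    exact hfdc.norm.mul_right
  have hL : Integrable (fun x => f x * HSW e b x) := by
    apply Continuous.integrable_of_hasCompactSupport (hf.continuous.mul (HSW_continuous he _))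
    exact hc.mul_right
  calc ∫ x, f x * HSW e b x
      ≤ ∫ x, ∑ i, f x * fderiv ℝ (g i) x (EuclideanSpace.single i 1) := by
        apply integral_mono hL (integrable_finsetSum _ (fun i _ => i2 i))
        intro x
        simp only
        rw [← Finset.mul_sum]
        apply mul_le_mul_of_nonneg_left _ (hf0 x)
        simp_rw [hgd]
        rw [Finset.sum_add_distrib, ← Finset.sum_mul, ← EuclideanSpace.real_norm_sq_eq]
        simp only [Finset.sum_const, Finset.card_univ, Fintype.card_fin, nsmul_eq_mul]
        have := HSW_sq_mul he b x
        have hN' : (3:ℝ) ≤ N := by exact_mod_cast hN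
        have h2b : 2 * b = 1 - N := by rw [hb]; ring
        rw [h2b]
        nlinarith
    _ = ∫ x, -∑ i, fderiv ℝ f x (EuclideanSpace.single i 1) * g i x := key
    _ ≤ _ := by
        apply integral_mono (integrable_finsetSum _ (fun i _ => i1 i)).neg hR
        intro x
        simp only
        have hsum : ∑ i, fderiv ℝ f x (EuclideanSpace.single i 1) * g i x =
            fderiv ℝ f x x * HSW e b x := by
          have hx : x = ∑ i, x i • EuclideanSpace.single i (1:ℝ) := by
            ext j; simp [Finset.sum_apply, Pi.single_apply]
          conv_rhs => rw [hx, map_sum, Finset.sum_mul]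
          rw [← hx]
          refine Finset.sum_congr rfl fun i _ => ?_
          simp [g]; ring
        change -(∑ i, fderiv ℝ f x (EuclideanSpace.single i 1) * g i x) ≤ _
        rw [hsum]
        have h1 : -(fderiv ℝ f x x) ≤ ‖fderiv ℝ f x‖ * ‖x‖ :=
          (neg_le_abs _).trans ((fderiv ℝ f x).le_opNorm x)
        have h2 := HSW_norm_mul he ((2 - (N:ℝ)) / 2) x
        have h3 : (2 - (N:ℝ)) / 2 - 1/2 = b := by rw [hb]; ring
        rw [h3] at h2
        calc -(fderiv ℝ f x x * HSW e b x) = -(fderiv ℝ f x x) * HSW e b x := by ring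
          _ ≤ (‖fderiv ℝ f x‖ * ‖x‖) * HSW e b x :=
            mul_le_mul_of_nonneg_right h1 (HSW_pos he b x).le
          _ = ‖fderiv ℝ f x‖ * (‖x‖ * HSW e b x) := by ring
          _ ≤ _ := mul_le_mul_of_nonneg_left h2 (norm_nonneg _)

lemma HS_fderiv {N : ℕ} (hN : 3 ≤ N) {e : ℝ} (he : 0 < e)
    (f : EuclideanSpace ℝ (Fin N) → ℝ) (hf : ContDiff ℝ 1 f) (hc : HasCompactSupport f)
    (hf0 : ∀ x, 0 ≤ f x) :
    ∫ x, ‖fderiv ℝ (fun x => f x * HSW e ((2 - (N:ℝ)) / 2) x) x‖ ≤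
      ((N:ℝ) - 1) * ∫ x, ‖fderiv ℝ f x‖ * HSW e ((2 - (N:ℝ)) / 2) x := by
  set a : ℝ := (2 - (N:ℝ)) / 2 with ha
  have hN' : (3:ℝ) ≤ N := by exact_mod_cast hN
  have hfd : Continuous (fderiv ℝ f) := hf.continuous_fderiv one_ne_zero
  have hfdc : HasCompactSupport (fderiv ℝ f) := hc.fderiv ℝ
  have hR : Integrable (fun x => ‖fderiv ℝ f x‖ * HSW e a x) := by
    apply Continuous.integrable_of_hasCompactSupport (hfd.norm.mul (HSW_continuous he _))
    exact hfdc.norm.mul_right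
  have hL : Integrable (fun x => f x * HSW e ((1 - (N:ℝ)) / 2) x) := by
    apply Continuous.integrable_of_hasCompactSupport (hf.continuous.mul (HSW_continuous he _))
    exact hc.mul_right
  have hgc : ContDiff ℝ 1 (fun x => f x * HSW e a x) := hf.mul (HSW_contDiff he a)
  have hI : Integrable (fun x => ‖fderiv ℝ (fun x => f x * HSW e a x) x‖) := by
    apply Continuous.integrable_of_hasCompactSupport (hgc.continuous_fderiv one_ne_zero).norm
    exact (HasCompactSupport.fderiv ℝ (hc.mul_right)).norm
  calc ∫ x, ‖fderiv ℝ (fun x => f x * HSW e a x) x‖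
      ≤ ∫ x, (‖fderiv ℝ f x‖ * HSW e a x
          + ((N:ℝ) - 2) * (f x * HSW e ((1 - (N:ℝ)) / 2) x)) := by
        apply integral_mono hI (hR.add (hL.const_mul _))
        intro x
        have hd := ((hf.differentiable one_ne_zero x).hasFDerivAt.mul (HSW_hasFDerivAt he a x)).fderiv
        change ‖fderiv ℝ (f * HSW e a) x‖ ≤ _
        rw [hd]
        refine (norm_add_le _ _).trans ?_
        rw [norm_smul, norm_smul, norm_smul, add_comm]
        simp only [innerSL_apply_norm]
        have hw := HSW_pos he a x
        have hw1 := HSW_pos he (a-1) x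
        have h2 := HSW_norm_mul he ((1 - (N:ℝ)) / 2) x
        have h3 : (1 - (N:ℝ)) / 2 - 1/2 = a - 1 := by rw [ha]; ring
        rw [h3] at h2
        have h2a : 2 * a = -(N - 2) := by rw [ha]; ring
        rw [h2a, Real.norm_of_nonneg (hf0 x), Real.norm_of_nonneg hw.le, norm_mul, norm_neg,
          Real.norm_of_nonneg hw1.le, Real.norm_of_nonneg (by linarith : (0:ℝ) ≤ N - 2)]
        have h4 := mul_le_mul_of_nonneg_left h2
          (mul_nonneg (hf0 x) (by linarith : (0:ℝ) ≤ N - 2))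
        change _ ≤ ‖fderiv ℝ f x‖ * HSW e a x + ((N:ℝ) - 2) * (f x * HSW e ((1 - (N:ℝ)) / 2) x)
        nlinarith
    _ = (∫ x, ‖fderiv ℝ f x‖ * HSW e a x)
          + ((N:ℝ) - 2) * ∫ x, f x * HSW e ((1 - (N:ℝ)) / 2) x := by
        rw [integral_add hR (hL.const_mul _), integral_const_mul]
    _ ≤ _ := by
        have := HS_hardy hN he f hf hc hf0
        rw [← ha] at this
        nlinarith

lemma HS_sobolev {N : ℕ} (hN : 3 ≤ N) : ∃ C : ℝ, 0 < C ∧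
    ∀ u : EuclideanSpace ℝ (Fin N) → ℝ, ContDiff ℝ 1 u → HasCompactSupport u →
      (∀ x, 0 ≤ u x) →
      ∫ x, u x ^ ((N:ℝ) / (N - 1)) ≤ C * (∫ x, ‖fderiv ℝ u x‖) ^ ((N:ℝ) / (N - 1)) := by
  have hN' : (3:ℝ) ≤ N := by exact_mod_cast hN
  set p : ℝ := (N:ℝ) / (N - 1) with hp
  have hp0 : 0 < p := by rw [hp]; apply div_pos <;> linarith
  have hconj : Real.HolderConjugate (Module.finrank ℝ (EuclideanSpace ℝ (Fin N))) p := by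
    simp only [finrank_euclideanSpace, Fintype.card_fin]
    exact Real.HolderConjugate.conjExponent (by linarith)
  set K := lintegralPowLePowLIntegralFDerivConst (volume : Measure (EuclideanSpace ℝ (Fin N))) p
  refine ⟨K + 1, by positivity, fun u hu hc hu0 => ?_⟩
  have h := lintegral_pow_le_pow_lintegral_fderiv (volume) hu hc hconj
  have hfi : Integrable (fun x => ‖fderiv ℝ u x‖) :=
    ((hu.continuous_fderiv one_ne_zero).norm).integrable_of_hasCompactSupport
      (hc.fderiv ℝ).norm
  have hr : ∫⁻ x, ‖fderiv ℝ u x‖ₑ = ENNReal.ofReal (∫ x, ‖fderiv ℝ u x‖) := by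
    rw [ofReal_integral_eq_lintegral_ofReal hfi (.of_forall fun x => norm_nonneg _)]
    simp_rw [ofReal_norm]
  have hl : ∫ x, u x ^ p = (∫⁻ x, ‖u x‖ₑ ^ p).toReal := by
    rw [integral_eq_lintegral_of_nonneg_ae (.of_forall fun x => by have := hu0 x; positivity)]
    · congr 2
      ext x
      rw [← ENNReal.ofReal_rpow_of_nonneg (hu0 x) hp0.le, ← ofReal_norm,
        Real.norm_of_nonneg (hu0 x)]
    · exact (hu.continuous.rpow_const (fun x => Or.inr hp0.le)).aestronglyMeasurable
  have h0 : 0 ≤ ∫ x, ‖fderiv ℝ u x‖ := integral_nonneg fun x => norm_nonneg _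
  rw [hr, ENNReal.ofReal_rpow_of_nonneg h0 hp0.le] at h
  rw [hl]
  have h5 := ENNReal.toReal_mono (ENNReal.mul_ne_top ENNReal.coe_ne_top ENNReal.ofReal_ne_top) h
  rw [ENNReal.toReal_mul, ENNReal.toReal_ofReal (by positivity), ENNReal.coe_toReal] at h5
  refine h5.trans ?_
  gcongr
  linarith

lemma HS_algebra {n A B D c K : ℝ} (hn : 3 ≤ n) (hA : 0 ≤ A) (hB : 0 ≤ B) (hc : 0 < c)
    (hK : 0 < K) (hD0 : 0 ≤ D) (hD : D ≤ A ^ (1/2:ℝ) * B ^ (1/2:ℝ))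
    (h : c * A ≤ K * D ^ (n / (n - 1))) :
    ((K / c) ^ (2 * (n - 1) / n))⁻¹ * A ^ ((n - 2) / n) ≤ B := by
  have hn1 : 0 < n - 1 := by linarith
  have hn0 : 0 < n := by linarith
  rcases hA.eq_or_lt with rfl | hA'
  · rw [Real.zero_rpow (by have : 0 < (n-2)/n := div_pos (by linarith) hn0
                           exact this.ne')]
    simpa using hB
  have hKc : 0 < K / c := by positivity
  have h1 : A ≤ (K / c) * (A ^ (1/2:ℝ) * B ^ (1/2:ℝ)) ^ (n / (n - 1)) := by
    have : D ^ (n / (n - 1)) ≤ (A ^ (1/2:ℝ) * B ^ (1/2:ℝ)) ^ (n / (n - 1)) :=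
      Real.rpow_le_rpow hD0 hD (by positivity)
    calc A = (c * A) / c := by field_simp
      _ ≤ (K * (A ^ (1/2:ℝ) * B ^ (1/2:ℝ)) ^ (n / (n - 1))) / c := by
        apply div_le_div_of_nonneg_right _ hc.le
        exact h.trans (mul_le_mul_of_nonneg_left this hK.le)
      _ = _ := by ring
  have h2 := Real.rpow_le_rpow hA h1 (z := 2 * (n - 1) / n) (by positivity)
  rw [Real.mul_rpow hKc.le (by positivity), ← Real.rpow_mul (by positivity),
    Real.mul_rpow (by positivity) (by positivity), ← Real.rpow_mul hA, ← Real.rpow_mul hB,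
    show 1 / 2 * (n / (n - 1) * (2 * (n - 1) / n)) = 1 by field_simp, Real.rpow_one,
    Real.rpow_one] at h2
  have h3 : A ^ (2 * (n - 1) / n) = A ^ ((n - 2) / n) * A := by
    rw [← Real.rpow_add_one hA'.ne']; congr 1; field_simp; ring
  rw [h3] at h2
  rw [inv_mul_le_iff₀ (by positivity)]
  have : A ^ ((n - 2) / n) * A ≤ ((K / c) ^ (2 * (n - 1) / n) * B) * A := by linarith
  exact le_of_mul_le_mul_right this hA'

lemma HS_eps {N : ℕ} (hN : 3 ≤ N) (R : ℝ) : ∃ C : ℝ, 0 < C ∧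
    ∀ e : ℝ, 0 < e → e ≤ 1 → ∀ v : EuclideanSpace ℝ (Fin N) → ℝ, ContDiff ℝ 1 v →
      HasCompactSupport v → (∀ x, v x ≠ 0 → ‖x‖ ≤ R) →
      C * (∫ x, |v x| ^ (2 * (N : ℝ) / ((N : ℝ) - 2)) * HSW e ((2 - (N:ℝ)) / 2) x) ^
            (((N : ℝ) - 2) / (N : ℝ)) ≤
        ∫ x, ‖fderiv ℝ v x‖ ^ 2 * HSW e ((2 - (N:ℝ)) / 2) x := by
  have hN' : (3:ℝ) ≤ N := by exact_mod_cast hN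
  obtain ⟨K, hK, hS⟩ := HS_sobolev hN
  set s : ℝ := 2 * ((N:ℝ) - 1) / (N - 2) with hs
  set p : ℝ := 2 * (N : ℝ) / ((N : ℝ) - 2) with hp
  set a : ℝ := (2 - (N:ℝ)) / 2 with ha
  set r : ℝ := (N:ℝ) / (N - 1) with hr
  have hN2 : (0:ℝ) < N - 2 := by linarith
  have hN1 : (0:ℝ) < N - 1 := by linarith
  have hN0 : (0:ℝ) < N := by linarith
  have hs1 : 1 < s := by rw [hs, lt_div_iff₀ hN2]; linarith
  have hs0 : 0 < s := by linarith
  have hp0 : 0 < p := by positivity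
  have hr0 : 0 < r := by positivity
  have hsr : s * r = p := by rw [hs, hr, hp]; field_simp
  have hsp : (s - 1) * 2 = p := by rw [hs, hp]; field_simp; ring
  set c : ℝ := (R ^ 2 + 1) ^ (a * (r - 1)) with hc
  have hc0 : 0 < c := by positivity
  set L : ℝ := K * (((N:ℝ) - 1) * s) ^ r with hL
  have hL0 : 0 < L := by positivity
  refine ⟨((L / c) ^ (2 * ((N:ℝ) - 1) / N))⁻¹, by positivity, fun e he he1 v hv hvc hvR => ?_⟩
  have hW := HSW_continuous (N := N) he
  have hWp := HSW_pos (N := N) he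
  have hvd : Continuous (fderiv ℝ v) := hv.continuous_fderiv one_ne_zero
  have hvdc : HasCompactSupport (fderiv ℝ v) := hvc.fderiv ℝ
  have hpow : ∀ t : ℝ, 0 < t → HasCompactSupport (fun x => ‖v x‖ ^ t) := fun t ht =>
    hvc.comp_left (g := fun y : ℝ => ‖y‖ ^ t) (by simp [ht.ne'])
  have hpowc : ∀ t : ℝ, 0 < t → Continuous (fun x => ‖v x‖ ^ t) := fun t ht =>
    hv.continuous.norm.rpow_const (fun _ => Or.inr ht.le)
  let f : EuclideanSpace ℝ (Fin N) → ℝ := fun x => ‖v x‖ ^ s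
  have hf : ContDiff ℝ 1 f := hv.norm_rpow hs1
  have hfc : HasCompactSupport f := hpow s hs0
  have hf0 : ∀ x, 0 ≤ f x := fun x => by positivity
  have hfd := HS_fderiv hN he f hf hfc hf0
  rw [← ha] at hfd
  have hfW := hS (fun x => f x * HSW e a x) (hf.mul (HSW_contDiff he a)) hfc.mul_right
    (fun x => mul_nonneg (hf0 x) (hWp a x).le)
  set D : ℝ := ∫ x, ‖v x‖ ^ (s - 1) * ‖fderiv ℝ v x‖ * HSW e a x with hD
  have hD0 : 0 ≤ D := integral_nonneg fun x =>
    mul_nonneg (by positivity) (hWp a x).le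
  have hDi : Integrable (fun x => ‖v x‖ ^ (s - 1) * ‖fderiv ℝ v x‖ * HSW e a x) := by
    apply Continuous.integrable_of_hasCompactSupport
    · exact ((hpowc _ (by linarith)).mul hvd.norm).mul (hW a)
    · exact ((hpow _ (by linarith)).mul_right).mul_right
  have h1 : ∫ x, ‖fderiv ℝ f x‖ * HSW e a x ≤ s * D := by
    rw [hD, ← integral_const_mul]
    apply integral_mono
    · apply Continuous.integrable_of_hasCompactSupport
        ((hf.continuous_fderiv one_ne_zero).norm.mul (hW a))
      exact (hfc.fderiv ℝ).norm.mul_right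
    · exact hDi.const_mul _
    · intro x
      have := mul_le_mul_of_nonneg_right
        (norm_fderiv_norm_rpow_le (hv.differentiable one_ne_zero) (x := x) hs1) (hWp a x).le
      change ‖fderiv ℝ (fun x => ‖v x‖ ^ s) x‖ * HSW e a x ≤ _
      refine this.trans (le_of_eq ?_)
      simp only
      ring
  have h2 : ∫ x, (f x * HSW e a x) ^ r ≤ L * D ^ r := by
    refine hfW.trans ?_
    rw [hL, mul_assoc, ← Real.mul_rpow (by positivity) hD0]
    have h0 : 0 ≤ ∫ x, ‖fderiv ℝ (fun x => f x * HSW e a x) x‖ :=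
      integral_nonneg fun x => norm_nonneg _
    gcongr
    refine hfd.trans ?_
    rw [mul_assoc]
    gcongr
  have hAi : Integrable (fun x => |v x| ^ p * HSW e a x) := by
    apply Continuous.integrable_of_hasCompactSupport ((hpowc p hp0).mul (hW a))
    exact (hpow p hp0).mul_right
  have h3 : c * ∫ x, |v x| ^ p * HSW e a x ≤ ∫ x, (f x * HSW e a x) ^ r := by
    rw [← integral_const_mul]
    apply integral_mono (hAi.const_mul _)
    · apply Continuous.integrable_of_hasCompactSupport
      · exact (hf.continuous.mul (hW a)).rpow_const (fun _ => Or.inr hr0.le)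
      · exact (hfc.mul_right (f' := HSW e a)).comp_left (g := fun y : ℝ => y ^ r)
          (by simp [hr0.ne'])
    · intro x
      simp only
      rw [Real.mul_rpow (hf0 x) (hWp a x).le]
      have e1 : f x ^ r = |v x| ^ p := by
        simp only [f]
        rw [← Real.rpow_mul (norm_nonneg _), hsr, Real.norm_eq_abs]
      rw [e1]
      by_cases hx : v x = 0
      · simp [hx, hp0.ne']
      have hxR := hvR x hx
      have hq : 0 < ‖x‖ ^ 2 + e := by positivity
      have e2 : HSW e a x ^ r = HSW e a x * (‖x‖ ^ 2 + e) ^ (a * (r - 1)) := by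
        unfold HSW
        rw [← Real.rpow_mul hq.le, ← Real.rpow_add hq]; congr 1; ring
      have e3 : c ≤ (‖x‖ ^ 2 + e) ^ (a * (r - 1)) := by
        apply Real.rpow_le_rpow_of_nonpos hq
        · gcongr
        · apply mul_nonpos_of_nonpos_of_nonneg
          · rw [ha]; linarith
          · have : 1 ≤ r := by rw [hr, le_div_iff₀ hN1]; linarith
            linarith
      rw [e2]
      have := mul_le_mul_of_nonneg_left e3
        (mul_nonneg (by positivity : 0 ≤ |v x| ^ p) (hWp a x).le)
      linarith
  have hA0 : 0 ≤ ∫ x, |v x| ^ p * HSW e a x := integral_nonneg fun x =>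
    mul_nonneg (by positivity) (hWp a x).le
  have hB0 : 0 ≤ ∫ x, ‖fderiv ℝ v x‖ ^ 2 * HSW e a x := integral_nonneg fun x =>
    mul_nonneg (by positivity) (hWp a x).le
  refine HS_algebra hN' hA0 hB0 hc0 hL0 hD0 ?_ (h3.trans h2)
  have hsq : Continuous (fun x : EuclideanSpace ℝ (Fin N) => HSW e a x ^ (1/2:ℝ)) :=
    (hW a).rpow_const (fun _ => Or.inr (by norm_num))
  have hwsq : ∀ x : EuclideanSpace ℝ (Fin N), (HSW e a x ^ (1/2:ℝ)) ^ (2:ℝ) = HSW e a x := by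
    intro x
    rw [← Real.rpow_mul (hWp a x).le]; norm_num
  have hol := integral_mul_le_Lp_mul_Lq_of_nonneg
    (μ := (volume : Measure (EuclideanSpace ℝ (Fin N)))) Real.HolderConjugate.two_two
    (f := fun x => ‖v x‖ ^ (s - 1) * HSW e a x ^ (1/2:ℝ))
    (g := fun x => ‖fderiv ℝ v x‖ * HSW e a x ^ (1/2:ℝ))
    (.of_forall fun x => mul_nonneg (by positivity) (Real.rpow_nonneg (hWp a x).le _))
    (.of_forall fun x => mul_nonneg (by positivity) (Real.rpow_nonneg (hWp a x).le _))
    (Continuous.memLp_of_hasCompactSupport ((hpowc _ (by linarith)).mul hsq)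
      (hpow _ (by linarith)).mul_right)
    (Continuous.memLp_of_hasCompactSupport (hvd.norm.mul hsq) hvdc.norm.mul_right)
  have r1 : D = ∫ x, (‖v x‖ ^ (s - 1) * HSW e a x ^ (1/2:ℝ)) *
      (‖fderiv ℝ v x‖ * HSW e a x ^ (1/2:ℝ)) := by
    rw [hD]
    refine integral_congr_ae (.of_forall fun x => ?_)
    have := hwsq x
    rw [Real.rpow_two] at this
    simp only
    linear_combination (-(‖v x‖ ^ (s - 1) * ‖fderiv ℝ v x‖)) * this
  have r2 : ∫ x, |v x| ^ p * HSW e a x =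
      ∫ x, (‖v x‖ ^ (s - 1) * HSW e a x ^ (1/2:ℝ)) ^ (2:ℝ) := by
    refine integral_congr_ae (.of_forall fun x => ?_)
    simp only
    rw [Real.mul_rpow (by positivity) (Real.rpow_nonneg (hWp a x).le _), hwsq,
      ← Real.rpow_mul (norm_nonneg _), hsp, Real.norm_eq_abs]
  have r3 : ∫ x, ‖fderiv ℝ v x‖ ^ 2 * HSW e a x =
      ∫ x, (‖fderiv ℝ v x‖ * HSW e a x ^ (1/2:ℝ)) ^ (2:ℝ) := by
    refine integral_congr_ae (.of_forall fun x => ?_)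
    simp only
    rw [Real.mul_rpow (by positivity) (Real.rpow_nonneg (hWp a x).le _), hwsq, Real.rpow_two]
  rw [r1, r2, r3]
  exact hol

lemma HS_locInt {N : ℕ} (hN : 3 ≤ N) :
    LocallyIntegrable (fun x : EuclideanSpace ℝ (Fin N) => ‖x‖ ^ (2 - (N:ℝ))) volume := by
  have : Nonempty (Fin N) := ⟨⟨0, by omega⟩⟩
  have : Nontrivial (EuclideanSpace ℝ (Fin N)) := inferInstance
  rw [locallyIntegrable_iff]
  intro k hk
  obtain ⟨r, hr⟩ := hk.isBounded.subset_ball (0 : EuclideanSpace ℝ (Fin N))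
  refine IntegrableOn.mono_set ?_ hr
  rw [integrableOn_fun_norm_addHaar volume (f := fun y : ℝ => y ^ (2 - (N:ℝ)))]
  have h1 : IntegrableOn (fun y : ℝ => y) (Set.Ioo 0 r) :=
    (continuous_id.integrableOn_Icc (a := 0) (b := r)).mono_set Set.Ioo_subset_Icc_self
  refine h1.congr_fun ?_ measurableSet_Ioo
  intro y hy
  simp only [finrank_euclideanSpace, Fintype.card_fin, smul_eq_mul]
  rw [← Real.rpow_natCast, ← Real.rpow_add hy.1, Nat.cast_sub (by omega)]
  rw [show ((N:ℝ) - (1:ℕ) + (2 - N)) = 1 by push_cast; ring, Real.rpow_one]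

lemma HS_integrable {N : ℕ} (hN : 3 ≤ N) (g : EuclideanSpace ℝ (Fin N) → ℝ)
    (hg : Continuous g) (hc : HasCompactSupport g) :
    Integrable (fun x => g x * ‖x‖ ^ (2 - (N:ℝ))) :=
  (HS_locInt hN).integrable_smul_left_of_hasCompactSupport hg hc

lemma HSW_le {N : ℕ} (hN : 3 ≤ N) {e : ℝ} (he : 0 < e) {x : EuclideanSpace ℝ (Fin N)}
    (hx : x ≠ 0) : HSW e ((2 - (N:ℝ)) / 2) x ≤ ‖x‖ ^ (2 - (N:ℝ)) := by
  have hN' : (3:ℝ) ≤ N := by exact_mod_cast hN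
  have hx' : 0 < ‖x‖ := norm_pos_iff.2 hx
  have : ‖x‖ ^ (2 - (N:ℝ)) = (‖x‖ ^ 2) ^ ((2 - (N:ℝ)) / 2) := by
    rw [← Real.rpow_two, ← Real.rpow_mul hx'.le]; congr 1; ring
  rw [this]
  apply Real.rpow_le_rpow_of_nonpos (by positivity) (by linarith) (by linarith)

lemma HS_tendsto {N : ℕ} (hN : 3 ≤ N) (g : EuclideanSpace ℝ (Fin N) → ℝ)
    (hg : Continuous g) (hc : HasCompactSupport g) (hg0 : ∀ x, 0 ≤ g x) :
    Filter.Tendsto (fun n : ℕ => ∫ x, g x * HSW (1 / ((n:ℝ) + 1)) ((2 - (N:ℝ)) / 2) x)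
      Filter.atTop (nhds (∫ x, g x * ‖x‖ ^ (2 - (N:ℝ)))) := by
  have : Nonempty (Fin N) := ⟨⟨0, by omega⟩⟩
  have hae : ∀ᵐ x : EuclideanSpace ℝ (Fin N), x ≠ 0 := Measure.ae_ne volume 0
  refine tendsto_integral_of_dominated_convergence _ ?_ (HS_integrable hN g hg hc) ?_ ?_
  · intro n
    exact (hg.mul (HSW_continuous (by positivity) _)).aestronglyMeasurable
  · intro n
    filter_upwards [hae] with x hx
    rw [Real.norm_of_nonneg (mul_nonneg (hg0 x) (HSW_pos (by positivity) _ x).le)]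
    exact mul_le_mul_of_nonneg_left (HSW_le hN (by positivity) hx) (hg0 x)
  · filter_upwards [hae] with x hx
    have hx' : 0 < ‖x‖ := norm_pos_iff.2 hx
    apply Filter.Tendsto.const_mul
    have e1 : ‖x‖ ^ (2 - (N:ℝ)) = (‖x‖ ^ 2 + 0) ^ ((2 - (N:ℝ)) / 2) := by
      rw [add_zero, ← Real.rpow_two, ← Real.rpow_mul hx'.le]; congr 1; ring
    rw [e1]
    unfold HSW
    exact (tendsto_const_nhds.add tendsto_one_div_add_atTop_nhds_zero_nat).rpow_const
      (Or.inl (by positivity))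

/-- Improved Hardy–Sobolev inequality in the weighted space with weight `|x|^{2-N}`. -/
theorem hardy_sobolev_weighted
    (N : ℕ) (hN : 3 ≤ N)
    (Ω : Set (EuclideanSpace ℝ (Fin N))) (hΩo : IsOpen Ω) (hΩconn : IsConnected Ω)
    (hΩb : Bornology.IsBounded Ω) (hΩsm : IsC2Domain Ω)
    (h0 : (0 : EuclideanSpace ℝ (Fin N)) ∈ Ω) :
    ∃ C : ℝ, 0 < C ∧
      ∀ v : EuclideanSpace ℝ (Fin N) → ℝ,
        ContDiff ℝ (⊤ : ℕ∞) v → HasCompactSupport v → tsupport v ⊆ Ω →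
        C * (∫ x in Ω, |v x| ^ (2 * (N : ℝ) / ((N : ℝ) - 2)) * ‖x‖ ^ (2 - (N : ℝ))) ^
            (((N : ℝ) - 2) / (N : ℝ)) ≤
          ∫ x in Ω, ‖gradient v x‖ ^ 2 * ‖x‖ ^ (2 - (N : ℝ)) := by
  have hN' : (3:ℝ) ≤ N := by exact_mod_cast hN
  have hp0 : 0 < 2 * (N : ℝ) / ((N : ℝ) - 2) := div_pos (by linarith) (by linarith)
  have ht0 : 0 < ((N : ℝ) - 2) / (N : ℝ) := div_pos (by linarith) (by linarith)
  obtain ⟨R, hR⟩ := hΩb.subset_closedBall (0 : EuclideanSpace ℝ (Fin N))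
  obtain ⟨C, hC, h⟩ := HS_eps hN R
  refine ⟨C, hC, fun v hv hvc hvΩ => ?_⟩
  have hv1 : ContDiff ℝ 1 v := hv.of_le (by exact_mod_cast le_top)
  have hgrad : ∀ x, ‖gradient v x‖ = ‖fderiv ℝ v x‖ := fun x => by
    unfold gradient; simp
  have hvan : ∀ x, x ∉ Ω → v x = 0 := fun x hx =>
    image_eq_zero_of_notMem_tsupport fun h' => hx (hvΩ h')
  have hdvan : ∀ x, x ∉ Ω → fderiv ℝ v x = 0 := fun x hx =>
    fderiv_of_notMem_tsupport ℝ fun h' => hx (hvΩ h')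
  have hvR : ∀ x, v x ≠ 0 → ‖x‖ ≤ R := fun x hx => by
    have := hR (not_imp_comm.1 (hvan x) hx)
    simpa using this
  rw [setIntegral_eq_integral_of_forall_compl_eq_zero
      (fun x hx => by rw [hvan x hx]; simp [hp0.ne']),
    setIntegral_eq_integral_of_forall_compl_eq_zero
      (fun x hx => by rw [hgrad, hdvan x hx]; simp)]
  simp_rw [hgrad]
  have tA := HS_tendsto hN (fun x => |v x| ^ (2 * (N : ℝ) / ((N : ℝ) - 2)))
    (hv1.continuous.abs.rpow_const (fun _ => Or.inr hp0.le))
    (hvc.comp_left (g := fun y : ℝ => |y| ^ (2 * (N : ℝ) / ((N : ℝ) - 2))) (by simp [hp0.ne']))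
    (fun x => by positivity)
  have tB := HS_tendsto hN (fun x => ‖fderiv ℝ v x‖ ^ 2)
    ((hv1.continuous_fderiv one_ne_zero).norm.pow 2)
    ((hvc.fderiv ℝ).comp_left (g := fun y => ‖y‖ ^ 2) (by simp))
    (fun x => by positivity)
  refine le_of_tendsto_of_tendsto' ((tA.rpow_const (Or.inr ht0.le)).const_mul C) tB fun n => ?_
  exact h _ (by positivity) (by rw [div_le_one (by positivity)]; linarith [n.cast_nonneg (α := ℝ)])
    v hv1 hvc hvR
end
end
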